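/- Let 0 < σ < 1, α ≥ −1/2, β > −1/2 and 0 ≤ a, b < ∞. For j = 0, 1, 2, …, let u_j(θ) = (sin(θ/2))^{aj} (cos(θ/2))^{bj} for θ ∈ (0,π), and for a nonnegative measurable function f on (0,π) define T_j f(θ) = u_j(θ) ∫_0^π K_σ^{α+aj, β+bj}(θ,φ) u_j(φ)^{−1} f(φ) dμ_{α+aj, β+bj}(φ) ∈ [0,∞]. Suppose the exponents p, q satisfy max{(2α+2)/(α+3/2), (2β+2)/(β+3/2)} < p ≤ q < min{(2α+2)/(α+1/2), (2β+2)/(β+1/2)} and 1/q ≥ 1/p − min{σ/(2α+2), σ/(2β+2)}. Then there exists a constant C, depending only on σ, α, β, p and q, such that for all sequences (f_j)_{j≥0} of nonnegative measurable functions on (0,π): ‖ (Σ_{j=0}^∞ (T_j f_j)² )^{1/2} ‖_{L^q((0,π), dμ_{α,β})} ≤ C ‖ (Σ_{j=0}^∞ f_j² )^{1/2} ‖_{L^p((0,π), dμ_{α,β})}. -/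

import Mathlib

open MeasureTheory Real Set

/-- The measure `Π_γ` on `[-1,1]`: for `γ > -1/2` it has density
`Γ(γ+1)/(√π Γ(γ+1/2)) (1-u²)^{γ-1/2}`; for `γ = -1/2` it is `(δ_{-1}+δ_1)/2`. -/
noncomputable def jacobiPiMeasure (γ : ℝ) : Measure ℝ :=
  if γ = -(1/2) then (2 : ENNReal)⁻¹ • (Measure.dirac (-1) + Measure.dirac 1)
  else (volume.restrict (Icc (-1 : ℝ) 1)).withDensity
    (fun u => ENNReal.ofReal (Real.Gamma (γ + 1) / (Real.sqrt π * Real.Gamma (γ + 1/2)) *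
      (1 - u ^ 2) ^ (γ - 1/2)))

/-- `z(u,v,θ,φ) = u sin(θ/2) sin(φ/2) + v cos(θ/2) cos(φ/2)`. -/
noncomputable def zAux (u v θ φ : ℝ) : ℝ :=
  u * Real.sin (θ/2) * Real.sin (φ/2) + v * Real.cos (θ/2) * Real.cos (φ/2)

/-- The Jacobi–Poisson kernel `P_t^{α,β}(θ,φ)`. -/
noncomputable def jacobiPoissonKernel (α β t θ φ : ℝ) : ℝ :=
  Real.Gamma (α + β + 2) / (Real.Gamma (α + 1) * Real.Gamma (β + 1)) *
    ∫ v, ∫ u, (Real.exp (-t * (α + β + 1) / 2) * (1 - Real.exp (-t))) /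
      ((1 - Real.exp (-t/2)) ^ 2 + 2 * Real.exp (-t/2) * (1 - zAux u v θ φ)) ^ (α + β + 2)
      ∂(jacobiPiMeasure α) ∂(jacobiPiMeasure β)

/-- The Jacobi fractional integral kernel `K_σ^{α,β}(θ,φ) = (1/Γ(σ)) ∫_0^∞ P_t^{α,β}(θ,φ) t^{σ-1} dt`. -/
noncomputable def jacobiFracKernel (σ α β θ φ : ℝ) : ℝ :=
  (1 / Real.Gamma σ) * ∫ t in Ioi (0:ℝ), jacobiPoissonKernel α β t θ φ * t ^ (σ - 1)

/-- The measure `dμ_{α,β}(θ) = (sin(θ/2))^{2α+1} (cos(θ/2))^{2β+1} dθ` on `(0,π)`. -/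
noncomputable def jacobiMeasure (α β : ℝ) : Measure ℝ :=
  (volume.restrict (Ioo (0:ℝ) π)).withDensity
    (fun θ => ENNReal.ofReal ((Real.sin (θ/2)) ^ (2*α+1) * (Real.cos (θ/2)) ^ (2*β+1)))


open scoped ENNReal

lemma jac_lintegral_gamma {a r : ℝ} (ha : 0 < a) (hr : 0 < r) :
    ∫⁻ t in Ioi (0:ℝ), ENNReal.ofReal (t ^ (a - 1) * Real.exp (-(r * t))) =
      ENNReal.ofReal ((1 / r) ^ a * Real.Gamma a) := by
  have key := Real.integral_rpow_mul_exp_neg_mul_Ioi ha hr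
  have hG := Real.Gamma_pos_of_pos ha
  have hint : IntegrableOn (fun x : ℝ ↦ x ^ (a - 1) * rexp (-(r * x))) (Ioi 0) :=
    .of_integral_ne_zero (by rw [key]; positivity)
  rw [← key, ofReal_integral_eq_lintegral_ofReal hint]
  filter_upwards [ae_restrict_mem measurableSet_Ioi] with x hx
  have : (0:ℝ) < x := hx
  simp only [Pi.zero_apply]
  positivity

lemma jac_gamma_ratio {ε y : ℝ} (hε : 0 < ε) (hy : 2 * ε ≤ y) :
    Real.Gamma (y - ε) / Real.Gamma y ≤ Real.Gamma ε / Real.Gamma (2 * ε) := by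
  have h1 := Real.Gamma_pos_of_pos (show 0 < y - ε by linarith)
  have h2 := Real.Gamma_pos_of_pos (show 0 < y by linarith)
  have h3 := Real.Gamma_pos_of_pos hε
  have h4 := Real.Gamma_pos_of_pos (show 0 < 2 * ε by linarith)
  rcases hy.eq_or_lt with rfl | hy
  · rw [show 2 * ε - ε = ε by ring]
  have hc := Real.convexOn_log_Gamma
  -- y - ε and 2ε lie between ε and y
  have hl : 0 < y - ε := by linarith
  have A := hc.2 (show ε ∈ Ioi (0:ℝ) from hε) (show y ∈ Ioi (0:ℝ) by simp; linarith)
    (show 0 ≤ ε / (y - ε) by positivity)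
    (show 0 ≤ (y - 2 * ε) / (y - ε) from div_nonneg (by linarith) hl.le) (by field_simp; ring)
  have B := hc.2 (show ε ∈ Ioi (0:ℝ) from hε) (show y ∈ Ioi (0:ℝ) by simp; linarith)
    (show 0 ≤ (y - 2 * ε) / (y - ε) from div_nonneg (by linarith) hl.le)
    (show 0 ≤ ε / (y - ε) by positivity) (by field_simp; ring)
  have e1 : (ε / (y - ε)) * ε + ((y - 2 * ε) / (y - ε)) * y = y - ε := by field_simp; ring
  have e2 : ((y - 2 * ε) / (y - ε)) * ε + (ε / (y - ε)) * y = 2 * ε := by field_simp; ring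
  simp only [smul_eq_mul, e1, e2, Function.comp_apply] at A B
  have e3 : ε / (y - ε) + (y - 2 * ε) / (y - ε) = 1 := by field_simp; ring
  have C : Real.log (Real.Gamma (y - ε)) + Real.log (Real.Gamma (2 * ε)) ≤
      Real.log (Real.Gamma ε) + Real.log (Real.Gamma y) := by
    have e4 : (y - 2 * ε) / (y - ε) = 1 - ε / (y - ε) := by linarith
    rw [e4] at A B
    linarith
  rw [← Real.log_mul h1.ne' h4.ne', ← Real.log_mul h3.ne' h2.ne'] at C
  have D := (Real.log_le_log_iff (by positivity) (by positivity)).1 C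
  rw [div_le_div_iff₀ h2 h4]
  exact D

lemma jac_minkowski {Ω : Type*} [MeasurableSpace Ω] (ν : Measure Ω) (f : ℕ → Ω → ℝ≥0∞)
    (hf : ∀ j, Measurable (f j)) :
    ∑' j, (∫⁻ x, f j x ∂ν) ^ (2:ℝ) ≤ (∫⁻ x, (∑' j, f j x ^ (2:ℝ)) ^ (1/2 : ℝ) ∂ν) ^ (2:ℝ) := by
  set F : Ω → ℝ≥0∞ := fun x => (∑' j, f j x ^ (2:ℝ)) ^ (1/2 : ℝ) with hF
  have hFm : Measurable F := (Measurable.tsum fun j => (hf j).pow_const _).pow_const _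
  have hF2 : ∀ x, F x ^ (2:ℝ) = ∑' j, f j x ^ (2:ℝ) := by
    intro x; simp only [hF]; rw [← ENNReal.rpow_mul]; norm_num
  by_cases htop : ∫⁻ x, F x ∂ν = ⊤
  · rw [htop, ENNReal.top_rpow_of_pos (by norm_num)]; exact le_top
  have hae : ∀ᵐ x ∂ν, F x < ⊤ := ae_lt_top hFm htop
  have hle : ∀ j x, f j x ≤ F x := by
    intro j x
    have : f j x ^ (2:ℝ) ≤ F x ^ (2:ℝ) := by rw [hF2]; exact ENNReal.le_tsum j
    exact (ENNReal.rpow_le_rpow_iff (by norm_num)).1 this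
  have key : ∀ j, (∫⁻ x, f j x ∂ν) ^ (2:ℝ) ≤
      (∫⁻ x, F x ∂ν) * ∫⁻ x, f j x ^ (2:ℝ) / F x ∂ν := by
    intro j
    have hH := ENNReal.lintegral_mul_le_Lp_mul_Lq ν (p := 2) (q := 2)
      (by rw [Real.holderConjugate_iff]; norm_num)
      (f := fun x => F x ^ (1/2:ℝ)) (g := fun x => (f j x ^ (2:ℝ) / F x) ^ (1/2:ℝ))
      (hFm.pow_const _).aemeasurable ((((hf j).pow_const _).div hFm).pow_const _).aemeasurable
    have e1 : ∫⁻ x, f j x ∂ν ≤ ∫⁻ x, ((fun x => F x ^ (1/2:ℝ)) *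
        (fun x => (f j x ^ (2:ℝ) / F x) ^ (1/2:ℝ))) x ∂ν := by
      apply lintegral_mono_ae
      filter_upwards [hae] with x hx
      simp only [Pi.mul_apply]
      rw [← ENNReal.mul_rpow_of_nonneg _ _ (by norm_num)]
      by_cases h0 : F x = 0
      · have := hle j x; rw [h0] at this
        simp at this; simp [this]
      · rw [ENNReal.mul_div_cancel h0 hx.ne, ← ENNReal.rpow_mul]; norm_num
    have e2 := e1.trans hH
    have e3 := ENNReal.rpow_le_rpow e2 (show (0:ℝ) ≤ 2 by norm_num)
    refine e3.trans (le_of_eq ?_)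
    rw [ENNReal.mul_rpow_of_nonneg _ _ (by norm_num), ← ENNReal.rpow_mul, ← ENNReal.rpow_mul]
    simp only [← ENNReal.rpow_mul]
    norm_num
  calc ∑' j, (∫⁻ x, f j x ∂ν) ^ (2:ℝ) 
      ≤ ∑' j, (∫⁻ x, F x ∂ν) * ∫⁻ x, f j x ^ (2:ℝ) / F x ∂ν := ENNReal.tsum_le_tsum key
    _ = (∫⁻ x, F x ∂ν) * ∫⁻ x, (∑' j, f j x ^ (2:ℝ) / F x) ∂ν := by
        rw [ENNReal.tsum_mul_left, lintegral_tsum]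
        exact fun j => (((hf j).pow_const _).div hFm).aemeasurable
    _ ≤ (∫⁻ x, F x ∂ν) * ∫⁻ x, F x ∂ν := by
        gcongr with x
        simp only [div_eq_mul_inv]
        rw [ENNReal.tsum_mul_right, ← hF2]
        by_cases h0 : F x = 0
        · simp [h0]
        by_cases h1 : F x = ⊤
        · simp [h1]
        · rw [show (2:ℝ) = 1 + 1 by norm_num, ENNReal.rpow_add _ _ h0 h1, ENNReal.rpow_one, mul_assoc,
            ENNReal.mul_inv_cancel h0 h1, mul_one]
    _ = _ := by
        rw [show (2:ℝ) = ((2:ℕ):ℝ) by norm_num, ENNReal.rpow_natCast, sq]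

lemma jac_young (k g : ℝ → ℝ≥0∞) (hk : Measurable k) (hg : Measurable g) {p q r : ℝ}
    (hp : 0 < p) (hpq : p ≤ q) (hr : 1 ≤ r) (hr' : 1 / r = 1 + 1/q - 1/p) (hp1 : 1 ≤ p) :
    (∫⁻ s, (∫⁻ t, k (s - t) * g t) ^ q) ^ (1/q) ≤
      (∫⁻ t, k t ^ r) ^ (1/r) * (∫⁻ t, g t ^ p) ^ (1/p) := by
  have hq : 0 < q := by linarith
  have hr0 : 0 < r := by linarith
  have hqp : 1/q ≤ 1/p := one_div_le_one_div_of_le hp hpq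
  have hp1' : 1/p ≤ 1 := by rw [div_le_one hp]; exact hp1
  have hrq : 0 ≤ 1/r - 1/q := by rw [hr']; linarith
  set A := ∫⁻ t, k t ^ r with hA
  set B := ∫⁻ t, g t ^ p with hB
  have step : ∀ s, (∫⁻ t, k (s - t) * g t) ≤
      (∫⁻ t, k (s - t) ^ r * g t ^ p) ^ (1/q) * B ^ (1/p - 1/q) * A ^ (1/r - 1/q) := by
    intro s
    have hH := ENNReal.lintegral_prod_norm_pow_le (μ := (volume : Measure ℝ)) (Finset.univ : Finset (Fin 3))
      (f := ![fun t => k (s - t) ^ r * g t ^ p, fun t => g t ^ p, fun t => k (s - t) ^ r])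
      (p := ![1/q, 1/p - 1/q, 1/r - 1/q])
      (by
        intro i _
        have m1 : Measurable fun t => k (s - t) := hk.comp (measurable_const.sub measurable_id)
        fin_cases i
        · exact ((m1.pow_const _).mul (hg.pow_const _)).aemeasurable
        · exact (hg.pow_const _).aemeasurable
        · exact (m1.pow_const _).aemeasurable)
      (by rw [Fin.sum_univ_three]; simp only [Matrix.cons_val]; rw [hr']; ring)
      (by
        intro i _
        fin_cases i
        · simp only [Fin.zero_eta, Matrix.cons_val]; positivity
        · simp only [Fin.mk_one, Matrix.cons_val]; linarith
        · simpa using hrq)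
    simp only [Fin.prod_univ_three, Matrix.cons_val] at hH
    have e : ∫⁻ t, k (s - t) ^ r = A := by
      rw [hA]; exact lintegral_sub_left_eq_self (fun t => k t ^ r) s
    rw [e] at hH
    refine le_trans (le_of_eq ?_) hH
    refine lintegral_congr fun t => ?_
    rw [ENNReal.mul_rpow_of_nonneg _ _ (by positivity), ← ENNReal.rpow_mul, ← ENNReal.rpow_mul,
      ← ENNReal.rpow_mul, ← ENNReal.rpow_mul]
    have e1 : k (s-t) = k (s-t) ^ (r * (1/q)) * k (s-t) ^ (r * (1/r - 1/q)) := by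
      rw [← ENNReal.rpow_add_of_nonneg _ _ (by positivity) (by positivity), 
        show r * (1/q) + r * (1/r - 1/q) = 1 by field_simp; ring, ENNReal.rpow_one]
    have e2 : g t = g t ^ (p * (1/q)) * g t ^ (p * (1/p - 1/q)) := by
      have : 0 ≤ 1/p - 1/q := by linarith
      rw [← ENNReal.rpow_add_of_nonneg _ _ (by positivity) (by positivity), 
        show p * (1/q) + p * (1/p - 1/q) = 1 by field_simp; ring, ENNReal.rpow_one]
    calc k (s-t) * g t = (k (s-t) ^ (r * (1/q)) * k (s-t) ^ (r * (1/r - 1/q))) *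
          (g t ^ (p * (1/q)) * g t ^ (p * (1/p - 1/q))) := by rw [← e1, ← e2]
      _ = _ := by ring
  have hm : Measurable (Function.uncurry fun s t => k (s - t) ^ r * g t ^ p) :=
    ((hk.comp (measurable_fst.sub measurable_snd)).pow_const _).mul
      ((hg.comp measurable_snd).pow_const _)
  have hdouble : ∫⁻ s, ∫⁻ t, k (s - t) ^ r * g t ^ p = A * B := by
    rw [lintegral_lintegral_swap hm.aemeasurable]
    have : ∀ t, ∫⁻ s, k (s - t) ^ r * g t ^ p = A * g t ^ p := by
      intro t
      have hm' : Measurable fun s => k (s - t) ^ r :=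
        (hk.comp (measurable_id.sub measurable_const)).pow_const _
      rw [lintegral_mul_const _ hm']
      congr 1
      exact lintegral_sub_right_eq_self (fun t => k t ^ r) t
    simp_rw [this]
    rw [lintegral_const_mul _ (hg.pow_const _)]
  calc (∫⁻ s, (∫⁻ t, k (s - t) * g t) ^ q) ^ (1/q) 
      ≤ (∫⁻ s, ((∫⁻ t, k (s - t) ^ r * g t ^ p) ^ (1/q) * B ^ (1/p - 1/q) * A ^ (1/r - 1/q)) ^ q) ^ (1/q) := by
        gcongr with s
        exact step s
    _ = (∫⁻ s, (∫⁻ t, k (s - t) ^ r * g t ^ p) * (B ^ (1/p - 1/q) * A ^ (1/r - 1/q)) ^ q) ^ (1/q) := by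
        congr 1
        refine lintegral_congr fun s => ?_
        rw [mul_assoc, ENNReal.mul_rpow_of_nonneg _ _ hq.le, ← ENNReal.rpow_mul,
          show 1/q*q = 1 by field_simp, ENNReal.rpow_one]
    _ = (A * B) ^ (1/q) * (B ^ (1/p - 1/q) * A ^ (1/r - 1/q)) := by
        have hm' : Measurable fun s => ∫⁻ t, k (s - t) ^ r * g t ^ p := hm.lintegral_prod_right'
        rw [lintegral_mul_const _ hm', hdouble, ENNReal.mul_rpow_of_nonneg _ _ (by positivity),
          ← ENNReal.rpow_mul, show q*(1/q) = 1 by field_simp, ENNReal.rpow_one]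
    _ = (A ^ (1/q) * A ^ (1/r - 1/q)) * (B ^ (1/q) * B ^ (1/p - 1/q)) := by
        rw [ENNReal.mul_rpow_of_nonneg _ _ (by positivity)]; ring
    _ = _ := by
        rw [← ENNReal.rpow_add_of_nonneg _ _ (by positivity) hrq, 
          ← ENNReal.rpow_add_of_nonneg _ _ (by positivity) (by linarith)]
        congr 2 <;> ring


lemma jac_pt1 {γ ε x u : ℝ} (hε : 0 ≤ ε) (hγ : -(1/2) < γ)
    (hu0 : 0 ≤ u) (hu1 : u < 1) :
    (1 - u^2) ^ (γ - 1/2) * Real.exp (u * x) ≤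
      2 ^ (γ + 1/2) * Real.exp x * ((1-u) ^ (γ + 1/2 - ε - 1) * Real.exp (-(x * (1 - u)))) := by
  have h1 : 0 < 1 - u := by linarith
  have h2 : 0 < 1 + u := by linarith
  have e1 : (1 - u^2) ^ (γ - 1/2) = (1-u) ^ (γ - 1/2) * (1+u) ^ (γ - 1/2) := by
    rw [← Real.mul_rpow h1.le h2.le]; congr 1; ring
  have e2 : (1+u) ^ (γ - 1/2) ≤ 2 ^ (γ + 1/2) :=
    (Real.rpow_le_rpow_of_exponent_le (by linarith) (by linarith)).trans
      (Real.rpow_le_rpow h2.le (by linarith) (by linarith))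
  have e3 : (1-u) ^ (γ - 1/2) ≤ (1-u) ^ (γ + 1/2 - ε - 1) :=
    Real.rpow_le_rpow_of_exponent_ge h1 (by linarith) (by linarith)
  have e4 : Real.exp (u * x) = Real.exp x * Real.exp (-(x * (1 - u))) := by
    rw [← Real.exp_add]; congr 1; ring
  rw [e1, e4]
  calc (1-u) ^ (γ - 1/2) * (1+u) ^ (γ - 1/2) * (Real.exp x * Real.exp (-(x * (1 - u))))
      ≤ (1-u) ^ (γ + 1/2 - ε - 1) * 2 ^ (γ + 1/2) * (Real.exp x * Real.exp (-(x * (1 - u)))) := by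
        gcongr
    _ = _ := by ring

lemma jac_bessel {γ ε x : ℝ} (hε : 0 ≤ ε) (hx : 0 < x) (hγ : -(1/2) < γ) (hεγ : ε < γ + 1/2) :
    ∫⁻ u, ENNReal.ofReal (Real.exp (u * x)) ∂(jacobiPiMeasure γ) ≤
      ENNReal.ofReal (4 * Real.Gamma (γ + 1) * 2 ^ γ *
        (Real.Gamma (γ + 1/2 - ε) / Real.Gamma (γ + 1/2)) * (1/x) ^ (γ + 1/2 - ε) * Real.exp x) := by
  have hG1 := Real.Gamma_pos_of_pos (show 0 < γ + 1 by linarith)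
  have hG2 := Real.Gamma_pos_of_pos (show 0 < γ + 1/2 by linarith)
  have hG3 := Real.Gamma_pos_of_pos (show 0 < γ + 1/2 - ε by linarith)
  have hpi : 1 ≤ Real.sqrt π := by
    rw [Real.one_le_sqrt]; linarith [Real.pi_gt_three]
  set c := Real.Gamma (γ + 1) / (Real.sqrt π * Real.Gamma (γ + 1/2)) with hc
  have hc0 : 0 < c := by positivity
  set G : ℝ → ℝ≥0∞ := (Ioi (0:ℝ)).indicator
    (fun w => ENNReal.ofReal (w ^ (γ + 1/2 - ε - 1) * Real.exp (-(x * w)))) with hG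
  have hGm : Measurable G := by
    apply Measurable.indicator _ measurableSet_Ioi
    fun_prop
  have hGi : ∫⁻ w, G w = ENNReal.ofReal ((1 / x) ^ (γ + 1/2 - ε) * Real.Gamma (γ + 1/2 - ε)) := by
    rw [hG, lintegral_indicator measurableSet_Ioi]
    exact jac_lintegral_gamma (by linarith) hx
  set M := c * (2 ^ (γ + 1/2) * Real.exp x) with hM
  have hM0 : 0 ≤ M := by positivity
  have hmeas : Measurable fun u : ℝ => ENNReal.ofReal (c * (1 - u ^ 2) ^ (γ - 1/2)) := by fun_prop
  rw [jacobiPiMeasure, if_neg (by linarith)]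
  refine (lintegral_withDensity_le_lintegral_mul _ hmeas _).trans ?_
  rw [← Measure.restrict_congr_set (Ioo_ae_eq_Icc (α := ℝ) (μ := volume))]
  calc ∫⁻ u in Ioo (-1:ℝ) 1, ((fun u : ℝ => ENNReal.ofReal (c * (1 - u ^ 2) ^ (γ - 1/2))) *
        fun u => ENNReal.ofReal (Real.exp (u * x))) u
      ≤ ∫⁻ u in Ioo (-1:ℝ) 1, ENNReal.ofReal M * (G (1 - u) + G (1 + u)) := by
        refine setLIntegral_mono' measurableSet_Ioo fun u hu => ?_
        simp only [Pi.mul_apply]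
        have h1 : (0:ℝ) < 1 - u := by linarith [hu.2]
        have h2 : (0:ℝ) < 1 + u := by linarith [hu.1]
        rw [← ENNReal.ofReal_mul' (Real.exp_pos _).le]
        rcases le_total 0 u with h0 | h0
        · refine le_trans ?_ (mul_le_mul_right (le_add_of_nonneg_right zero_le) _)
          rw [hG, indicator_of_mem (show 1 - u ∈ Ioi (0:ℝ) from h1), ← ENNReal.ofReal_mul hM0]
          apply ENNReal.ofReal_le_ofReal
          have := jac_pt1 (x := x) hε hγ h0 hu.2
          rw [mul_assoc, hM, mul_assoc c]
          exact mul_le_mul_of_nonneg_left this hc0.le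
        · refine le_trans ?_ (mul_le_mul_right (le_add_of_nonneg_left zero_le) _)
          rw [hG, indicator_of_mem (show 1 + u ∈ Ioi (0:ℝ) from h2), ← ENNReal.ofReal_mul hM0]
          apply ENNReal.ofReal_le_ofReal
          have := jac_pt1 (x := x) hε hγ (u := -u) (by linarith) (by linarith [hu.1])
          rw [neg_sq, sub_neg_eq_add] at this
          rw [mul_assoc, hM, mul_assoc c]
          refine mul_le_mul_of_nonneg_left (le_trans ?_ this) hc0.le
          have hb : 0 ≤ (1 - u^2) ^ (γ - 1/2) := Real.rpow_nonneg (by nlinarith) _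
          refine mul_le_mul_of_nonneg_left (Real.exp_le_exp.2 ?_) hb
          nlinarith
    _ ≤ ∫⁻ u : ℝ, ENNReal.ofReal M * (G (1 - u) + G (1 + u)) := setLIntegral_le_lintegral _ _
    _ = ENNReal.ofReal M * ((∫⁻ w, G w) + ∫⁻ w, G w) := by
        have m1 : Measurable fun u => G (1 - u) := hGm.comp (by fun_prop)
        have m2 : Measurable fun u => G (1 + u) := hGm.comp (by fun_prop)
        have m3 : Measurable fun u => G (1 - u) + G (1 + u) := m1.add m2
        rw [lintegral_const_mul _ m3, lintegral_add_left m1,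
          lintegral_sub_left_eq_self G 1, lintegral_add_left_eq_self G 1]
    _ ≤ _ := by
        rw [hGi, ← ENNReal.ofReal_add (by positivity) (by positivity), ← ENNReal.ofReal_mul hM0]
        apply ENNReal.ofReal_le_ofReal
        have e1 : (2:ℝ) ^ (γ + 1/2) ≤ 2 * 2 ^ γ := by
          rw [Real.rpow_add (by norm_num), mul_comm]
          gcongr
          calc (2:ℝ) ^ (1/2:ℝ) ≤ 2 ^ (1:ℝ) := Real.rpow_le_rpow_of_exponent_le (by norm_num) (by norm_num)
            _ = 2 := by simp
        have e2 : c ≤ Real.Gamma (γ + 1) / Real.Gamma (γ + 1/2) := by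
          rw [hc]
          apply div_le_div_of_nonneg_left hG1.le hG2
          nlinarith
        calc M * ((1 / x) ^ (γ + 1/2 - ε) * Real.Gamma (γ + 1/2 - ε) + (1 / x) ^ (γ + 1/2 - ε) * Real.Gamma (γ + 1/2 - ε))
            = c * (2 ^ (γ + 1/2) * Real.exp x) * (2 * ((1 / x) ^ (γ + 1/2 - ε) * Real.Gamma (γ + 1/2 - ε))) := by
              rw [hM]; ring
          _ ≤ (Real.Gamma (γ + 1) / Real.Gamma (γ + 1/2)) * ((2 * 2 ^ γ) * Real.exp x) * (2 * ((1 / x) ^ (γ + 1/2 - ε) * Real.Gamma (γ + 1/2 - ε))) := by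
              gcongr
          _ = _ := by ring


lemma jac_ofReal_integral_le {Ω : Type*} [MeasurableSpace Ω] (ν : Measure Ω) (f : Ω → ℝ) :
    ENNReal.ofReal (∫ x, f x ∂ν) ≤ ∫⁻ x, ENNReal.ofReal (f x) ∂ν := by
  by_cases hf : Integrable f ν
  · rw [integral_eq_lintegral_pos_part_sub_lintegral_neg_part hf]
    refine (ENNReal.ofReal_le_ofReal (sub_le_self _ ENNReal.toReal_nonneg)).trans ?_
    exact ENNReal.ofReal_toReal_le
  · rw [integral_undef hf]; simp

instance jac_sfinite (γ : ℝ) : SFinite (jacobiPiMeasure γ) := by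
  unfold jacobiPiMeasure
  split_ifs <;> infer_instance

lemma jac_ae_mem {γ : ℝ} (hγ : -(1/2) < γ) : ∀ᵐ u ∂(jacobiPiMeasure γ), u ∈ Icc (-1:ℝ) 1 := by
  rw [jacobiPiMeasure, if_neg (by linarith)]
  exact (withDensity_absolutelyContinuous _ _).ae_le (ae_restrict_mem measurableSet_Icc)

lemma jac_integrand {l t z : ℝ} (hz : 0 < Real.cosh (t/2) - z) :
    (Real.exp (-t * (l - 1) / 2) * (1 - Real.exp (-t))) /
      ((1 - Real.exp (-t/2)) ^ 2 + 2 * Real.exp (-t/2) * (1 - z)) ^ l =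
    2 ^ (1 - l) * Real.sinh (t/2) * (1 / (Real.cosh (t/2) - z)) ^ l := by
  have e1 : (1 - Real.exp (-t/2)) ^ 2 + 2 * Real.exp (-t/2) * (1 - z) =
      2 * Real.exp (-t/2) * (Real.cosh (t/2) - z) := by
    rw [Real.cosh_eq]
    have : Real.exp (-t/2) * Real.exp (t/2) = 1 := by rw [← Real.exp_add]; simp [neg_div]
    rw [show -(t/2) = -t/2 by ring]
    linear_combination -this
  have e2 : Real.exp (-t * (l - 1) / 2) * (1 - Real.exp (-t)) =
      Real.exp (-t/2) ^ l * (2 * Real.sinh (t/2)) := by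
    rw [← Real.exp_mul, Real.sinh_eq, show -t * (l-1)/2 = -t/2*l + t/2 by ring, Real.exp_add,
      show -t = -(t/2) + -(t/2) by ring, Real.exp_add]
    have : Real.exp (-(t/2)) * Real.exp (t/2) = 1 := by rw [← Real.exp_add]; simp
    linear_combination (-Real.exp ((-(t/2) + -(t/2))/2*l) * Real.exp (-(t/2))) * this
  rw [e1, e2, Real.mul_rpow (by positivity) hz.le, Real.mul_rpow (by norm_num) (Real.exp_pos _).le,
    Real.rpow_sub (by norm_num), Real.rpow_one, one_div, Real.inv_rpow hz.le]
  have h1 : Real.exp (-t/2) ^ l ≠ 0 := (Real.rpow_pos_of_pos (Real.exp_pos _) _).ne'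
  have h2 : (Real.cosh (t/2) - z) ^ l ≠ 0 := (Real.rpow_pos_of_pos hz _).ne'
  have h3 : (2:ℝ) ^ l ≠ 0 := (Real.rpow_pos_of_pos (by norm_num) _).ne'
  field_simp

lemma jac_triple (α β t s c l : ℝ) :
    ∫⁻ v, ∫⁻ u, (∫⁻ τ in Ioi (0:ℝ), ENNReal.ofReal (τ ^ (l-1) * Real.exp (-(t * τ))) *
      ENNReal.ofReal (Real.exp (u * (s * τ))) * ENNReal.ofReal (Real.exp (v * (c * τ))))
      ∂(jacobiPiMeasure α) ∂(jacobiPiMeasure β) =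
    ∫⁻ τ in Ioi (0:ℝ), ENNReal.ofReal (τ ^ (l-1) * Real.exp (-(t * τ))) *
      (∫⁻ u, ENNReal.ofReal (Real.exp (u * (s * τ))) ∂(jacobiPiMeasure α)) *
      (∫⁻ v, ENNReal.ofReal (Real.exp (v * (c * τ))) ∂(jacobiPiMeasure β)) := by
  have hL : Measurable fun τ : ℝ => ∫⁻ u, ENNReal.ofReal (Real.exp (u * (s * τ))) ∂(jacobiPiMeasure α) := by
    apply Measurable.lintegral_prod_right' (f := fun p : ℝ × ℝ => ENNReal.ofReal (Real.exp (p.2 * (s * p.1))))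
    fun_prop
  have h1 : ∀ v, ∫⁻ u, (∫⁻ τ in Ioi (0:ℝ), ENNReal.ofReal (τ ^ (l-1) * Real.exp (-(t * τ))) *
      ENNReal.ofReal (Real.exp (u * (s * τ))) * ENNReal.ofReal (Real.exp (v * (c * τ))))
      ∂(jacobiPiMeasure α) = ∫⁻ τ in Ioi (0:ℝ), ENNReal.ofReal (τ ^ (l-1) * Real.exp (-(t * τ))) *
      (∫⁻ u, ENNReal.ofReal (Real.exp (u * (s * τ))) ∂(jacobiPiMeasure α)) *
       ENNReal.ofReal (Real.exp (v * (c * τ))) := by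
    intro v
    rw [lintegral_lintegral_swap (by
      apply Measurable.aemeasurable
      unfold Function.uncurry
      fun_prop)]
    refine lintegral_congr fun τ => ?_
    rw [lintegral_mul_const _ (by fun_prop), lintegral_const_mul _ (by fun_prop)]
  simp_rw [h1]
  rw [lintegral_lintegral_swap (by
      apply Measurable.aemeasurable
      unfold Function.uncurry
      have : Measurable fun p : ℝ × ℝ => ∫⁻ u, ENNReal.ofReal (Real.exp (u * (s * p.2))) ∂(jacobiPiMeasure α) :=
        hL.comp measurable_snd
      fun_prop)]
  refine lintegral_congr fun τ => ?_
  rw [lintegral_const_mul _ (by fun_prop)]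

lemma jac_poisson {α β ε t θ φ : ℝ} (hα : -(1/2) < α) (hβ : -(1/2) < β) (hε : 0 ≤ ε)
    (hεβ : ε < β + 1/2) (ht : 0 < t) (hθ : θ ∈ Ioo 0 π) (hφ : φ ∈ Ioo 0 π) :
    jacobiPoissonKernel α β t θ φ ≤ 8 * (Real.Gamma (β + 1/2 - ε) / Real.Gamma (β + 1/2)) *
      Real.Gamma (1 + ε) * (Real.sinh (t/2) / (Real.cosh (t/2) - Real.cos ((θ - φ)/2)) ^ (1 + ε)) *
      ((Real.sin (θ/2) * Real.sin (φ/2)) ^ (-(α + 1/2)) *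
        (Real.cos (θ/2) * Real.cos (φ/2)) ^ (-(β + 1/2))) := by
  have hs1 : 0 < Real.sin (θ/2) := Real.sin_pos_of_pos_of_lt_pi (by linarith [hθ.1]) (by linarith [hθ.2, hθ.1])
  have hs2 : 0 < Real.sin (φ/2) := Real.sin_pos_of_pos_of_lt_pi (by linarith [hφ.1]) (by linarith [hφ.2, hφ.1])
  have hc1 : 0 < Real.cos (θ/2) := Real.cos_pos_of_mem_Ioo ⟨by linarith [hθ.1, hθ.2], by linarith [hθ.2]⟩
  have hc2 : 0 < Real.cos (φ/2) := Real.cos_pos_of_mem_Ioo ⟨by linarith [hφ.1, hφ.2], by linarith [hφ.2]⟩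
  set s := Real.sin (θ/2) * Real.sin (φ/2) with hs
  set c := Real.cos (θ/2) * Real.cos (φ/2) with hc
  have hs0 : 0 < s := by positivity
  have hc0 : 0 < c := by positivity
  have hsc : Real.cos ((θ - φ)/2) = s + c := by
    rw [sub_div, Real.cos_sub]; ring
  have hsc1 : s + c ≤ 1 := by rw [← hsc]; exact Real.cos_le_one _
  have hcosh : 1 < Real.cosh (t/2) := Real.one_lt_cosh.2 (by positivity)
  have hsinh : 0 < Real.sinh (t/2) := Real.sinh_pos_iff.2 (by positivity)
  set l := α + β + 2 with hl
  have hl0 : 0 < l := by linarith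
  have hGl := Real.Gamma_pos_of_pos hl0
  have hGa := Real.Gamma_pos_of_pos (show 0 < α + 1 by linarith)
  have hGb := Real.Gamma_pos_of_pos (show 0 < β + 1 by linarith)
  have hGa2 := Real.Gamma_pos_of_pos (show 0 < α + 1/2 by linarith)
  have hGb2 := Real.Gamma_pos_of_pos (show 0 < β + 1/2 by linarith)
  have hGb3 := Real.Gamma_pos_of_pos (show 0 < β + 1/2 - ε by linarith)
  have hGe := Real.Gamma_pos_of_pos (show 0 < 1 + ε by linarith)
  set ρ := Real.Gamma (β + 1/2 - ε) / Real.Gamma (β + 1/2) with hρ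
  have hρ0 : 0 < ρ := by positivity
  have hM : 0 < Real.cosh (t/2) - (s + c) := by linarith
  have hR : 0 ≤ 8 * ρ * Real.Gamma (1 + ε) * (Real.sinh (t/2) / (Real.cosh (t/2) - Real.cos ((θ - φ)/2)) ^ (1 + ε)) *
      (s ^ (-(α + 1/2)) * c ^ (-(β + 1/2))) := by
    rw [hsc]; positivity
  rw [← ENNReal.ofReal_le_ofReal_iff hR]
  set d := Real.Gamma l / (Real.Gamma (α + 1) * Real.Gamma (β + 1)) with hd
  have hd0 : 0 < d := by positivity
  unfold jacobiPoissonKernel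
  rw [ENNReal.ofReal_mul hd0.le]
  set m := 2 ^ (1 - l) * Real.sinh (t/2) / Real.Gamma l with hm
  have hm0 : 0 < m := by positivity
  have step1 : ENNReal.ofReal (∫ v, ∫ u, (Real.exp (-t * (α + β + 1) / 2) * (1 - Real.exp (-t))) /
      ((1 - Real.exp (-t/2)) ^ 2 + 2 * Real.exp (-t/2) * (1 - zAux u v θ φ)) ^ l
      ∂(jacobiPiMeasure α) ∂(jacobiPiMeasure β)) ≤
      ∫⁻ v, ∫⁻ u, (ENNReal.ofReal m * ∫⁻ τ in Ioi (0:ℝ), ENNReal.ofReal (τ ^ (l-1) * Real.exp (-(Real.cosh (t/2) * τ))) *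
      ENNReal.ofReal (Real.exp (u * (s * τ))) * ENNReal.ofReal (Real.exp (v * (c * τ))))
      ∂(jacobiPiMeasure α) ∂(jacobiPiMeasure β) := by
    refine (jac_ofReal_integral_le _ _).trans (lintegral_mono_ae ?_)
    filter_upwards [jac_ae_mem hβ] with v hv
    refine (jac_ofReal_integral_le _ _).trans (lintegral_mono_ae ?_)
    filter_upwards [jac_ae_mem hα] with u hu
    have hz : zAux u v θ φ = u * s + v * c := by unfold zAux; rw [hs, hc]; ring
    have hz0 : 0 < Real.cosh (t/2) - (u * s + v * c) := by nlinarith [hu.2, hv.2]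
    rw [hz, show α + β + 1 = l - 1 by rw [hl]; ring, jac_integrand hz0]
    rw [show 2 ^ (1 - l) * Real.sinh (t/2) * (1 / (Real.cosh (t/2) - (u * s + v * c))) ^ l =
      m * ((1 / (Real.cosh (t/2) - (u * s + v * c))) ^ l * Real.Gamma l) by rw [hm]; field_simp,
      ENNReal.ofReal_mul hm0.le, ← jac_lintegral_gamma hl0 hz0]
    apply le_of_eq
    congr 1
    refine setLIntegral_congr_fun measurableSet_Ioi fun τ hτ => ?_
    have : (0:ℝ) < τ := hτ
    rw [← ENNReal.ofReal_mul (by positivity), ← ENNReal.ofReal_mul (by positivity), mul_assoc, mul_assoc,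
      ← Real.exp_add, ← Real.exp_add]
    congr 3
    ring
  have step2 : ∫⁻ v, ∫⁻ u, (ENNReal.ofReal m * ∫⁻ τ in Ioi (0:ℝ), ENNReal.ofReal (τ ^ (l-1) * Real.exp (-(Real.cosh (t/2) * τ))) *
      ENNReal.ofReal (Real.exp (u * (s * τ))) * ENNReal.ofReal (Real.exp (v * (c * τ))))
      ∂(jacobiPiMeasure α) ∂(jacobiPiMeasure β) = ENNReal.ofReal m * 
      ∫⁻ τ in Ioi (0:ℝ), ENNReal.ofReal (τ ^ (l-1) * Real.exp (-(Real.cosh (t/2) * τ))) *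
      (∫⁻ u, ENNReal.ofReal (Real.exp (u * (s * τ))) ∂(jacobiPiMeasure α)) *
      (∫⁻ v, ENNReal.ofReal (Real.exp (v * (c * τ))) ∂(jacobiPiMeasure β)) := by
    rw [← jac_triple]
    rw [← lintegral_const_mul' _ _ ENNReal.ofReal_ne_top]
    refine lintegral_congr fun v => ?_
    rw [lintegral_const_mul' _ _ ENNReal.ofReal_ne_top]
  set B := 16 * Real.Gamma (α + 1) * Real.Gamma (β + 1) * 2 ^ (α + β) * ρ * s ^ (-(α + 1/2)) * c ^ (-(β + 1/2)) with hB
  have hB0 : 0 < B := by positivity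
  have step3 : ∫⁻ τ in Ioi (0:ℝ), ENNReal.ofReal (τ ^ (l-1) * Real.exp (-(Real.cosh (t/2) * τ))) *
      (∫⁻ u, ENNReal.ofReal (Real.exp (u * (s * τ))) ∂(jacobiPiMeasure α)) *
      (∫⁻ v, ENNReal.ofReal (Real.exp (v * (c * τ))) ∂(jacobiPiMeasure β)) ≤
      ENNReal.ofReal B * ∫⁻ τ in Ioi (0:ℝ), ENNReal.ofReal (τ ^ ((1 + ε) - 1) * Real.exp (-((Real.cosh (t/2) - (s + c)) * τ))) := by
    rw [← lintegral_const_mul' _ _ ENNReal.ofReal_ne_top]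
    refine setLIntegral_mono' measurableSet_Ioi fun τ hτ => ?_
    have hτ0 : (0:ℝ) < τ := hτ
    have hGa4 : 0 < Real.Gamma (α + 1/2 - 0) := by rwa [sub_zero]
    have b1 := jac_bessel le_rfl (show 0 < s * τ by positivity) hα (by linarith)
    have b2 := jac_bessel hε (show 0 < c * τ by positivity) hβ hεβ
    refine (mul_le_mul' (mul_le_mul' le_rfl b1) b2).trans ?_
    rw [← ENNReal.ofReal_mul (by positivity), ← ENNReal.ofReal_mul (by positivity), ← ENNReal.ofReal_mul (by positivity)]
    apply ENNReal.ofReal_le_ofReal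
    rw [sub_zero, div_self hGa2.ne', ← hρ]
    have x1 : (1 / (s * τ)) ^ (α + 1/2) = s ^ (-(α + 1/2)) * τ ^ (-(α + 1/2)) := by
      rw [one_div, Real.inv_rpow (by positivity), ← Real.rpow_neg (by positivity), Real.mul_rpow hs0.le hτ0.le]
    have x2 : (1 / (c * τ)) ^ (β + 1/2 - ε) ≤ c ^ (-(β + 1/2)) * τ ^ (-(β + 1/2 - ε)) := by
      rw [one_div, Real.inv_rpow (by positivity), ← Real.rpow_neg (by positivity), Real.mul_rpow hc0.le hτ0.le]
      gcongr ?_ * _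
      exact Real.rpow_le_rpow_of_exponent_ge hc0 (by linarith) (by linarith)
    have x3 : Real.exp (-((Real.cosh (t/2) - (s + c)) * τ)) = 
        Real.exp (-(Real.cosh (t/2) * τ)) * (Real.exp (s * τ) * Real.exp (c * τ)) := by
      rw [← Real.exp_add, ← Real.exp_add]; congr 1; ring
    have x4 : τ ^ ((1 + ε) - 1) = τ ^ (l - 1) * τ ^ (-(α + 1/2)) * τ ^ (-(β + 1/2 - ε)) := by
      rw [← Real.rpow_add hτ0, ← Real.rpow_add hτ0]; congr 1; rw [hl]; ring
    rw [x1, x3, x4, hB, Real.rpow_add (by norm_num)]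
    calc _ ≤ τ ^ (l - 1) * Real.exp (-(Real.cosh (t/2) * τ)) *
          (4 * Real.Gamma (α + 1) * 2 ^ α * 1 * (s ^ (-(α + 1/2)) * τ ^ (-(α + 1/2))) * Real.exp (s * τ)) *
          (4 * Real.Gamma (β + 1) * 2 ^ β * ρ * (c ^ (-(β + 1/2)) * τ ^ (-(β + 1/2 - ε))) * Real.exp (c * τ)) := by
          gcongr
      _ = _ := by ring
  calc ENNReal.ofReal d * _ ≤ ENNReal.ofReal d * (ENNReal.ofReal m * (ENNReal.ofReal B * 
        ENNReal.ofReal ((1 / (Real.cosh (t/2) - (s + c))) ^ (1 + ε) * Real.Gamma (1 + ε)))) := by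
        rw [← jac_lintegral_gamma (by linarith) hM]
        refine mul_le_mul' le_rfl (step1.trans ?_)
        rw [step2]
        exact mul_le_mul' le_rfl step3
    _ = _ := by
        rw [← ENNReal.ofReal_mul hB0.le, ← ENNReal.ofReal_mul hm0.le, ← ENNReal.ofReal_mul hd0.le]
        congr 1
        rw [hd, hm, hB, hsc, Real.div_rpow zero_le_one hM.le, Real.one_rpow,
          show 1 - l = -1 + -(α + β) by rw [hl]; ring, Real.rpow_add (by norm_num), Real.rpow_neg_one,
          Real.rpow_neg (by norm_num) (α + β)]
        have : (2:ℝ) ^ (α + β) ≠ 0 := (Real.rpow_pos_of_pos (by norm_num) _).ne'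
        field_simp
        ring


lemma jac_small_t {t x : ℝ} (ht : 0 < t) (ht1 : t ≤ 1) (hD : Real.sin x ≠ 0) :
    Real.sinh (t/2) / (Real.cosh (t/2) - Real.cos x) ≤ 8 * t / (t^2 + |Real.sin x|^2) := by
  have h1 : Real.sinh (t/2) ≤ t := by
    rw [Real.sinh_eq]
    have a1 := Real.abs_exp_sub_one_sub_id_le (x := t/2) (by rw [abs_of_pos (by positivity)]; linarith)
    have a2 := Real.add_one_le_exp (-(t/2))
    have a3 := (abs_le.1 a1).2
    nlinarith
  have h2 : 1 + t^2/8 ≤ Real.cosh (t/2) := by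
    have a1 : t/4 ≤ Real.sinh (t/4) := Real.self_le_sinh_iff.2 (by positivity)
    have a2 := Real.cosh_two_mul (t/4)
    have a3 := Real.cosh_sq (t/4)
    rw [show 2 * (t/4) = t/2 by ring] at a2
    nlinarith
  have hD2 : 0 < Real.sin x ^ 2 := by positivity
  have h3 : Real.cos x ≤ 1 - Real.sin x ^ 2 / 2 := by
    have := Real.sin_sq_add_cos_sq x
    nlinarith [Real.cos_le_one x, Real.neg_one_le_cos x, sq_nonneg (1 - Real.cos x)]
  rw [sq_abs]
  calc Real.sinh (t/2) / (Real.cosh (t/2) - Real.cos x) ≤ t / ((t^2 + Real.sin x ^ 2)/8) := by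
        apply div_le_div₀ ht.le h1 (by positivity)
        linarith
    _ = _ := by field_simp

lemma jac_large_t {t ε y : ℝ} (ht : 1 ≤ t) (hε : 0 ≤ ε) (hy : y ≤ 1) :
    Real.sinh (t/2) / (Real.cosh (t/2) - y) ^ (1 + ε) ≤ 18 ^ (1 + ε) * Real.exp (-(ε/2 * t)) := by
  have h1 : Real.sinh (t/2) ≤ Real.exp (t/2) := by
    rw [Real.sinh_eq]; linarith [Real.exp_pos (t/2), Real.exp_pos (-(t/2))]
  have h2 : Real.exp (t/2) / 18 ≤ Real.cosh (t/2) - y := by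
    have a1 := Real.add_one_le_exp (t/2)
    have a2 : 3/2 ≤ Real.exp (t/2) := by linarith
    have a3 : Real.exp (t/2) * Real.exp (-(t/2)) = 1 := by rw [← Real.exp_add]; simp
    set E := Real.exp (t/2)
    set F := Real.exp (-(t/2))
    have hF : 0 < F := Real.exp_pos _
    have hF2 : F ≤ 2/3 := by nlinarith
    rw [Real.cosh_eq]
    have : E / 18 ≤ (E + F)/2 - 1 := by
      have : E * (1 - F)^2 = E - 2 + F := by linear_combination (F - 2) * a3
      nlinarith [mul_nonneg (show 0 ≤ E by linarith) (show 0 ≤ (1 - F)^2 - 1/9 by nlinarith)]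
    linarith
  calc Real.sinh (t/2) / (Real.cosh (t/2) - y) ^ (1 + ε) ≤ Real.exp (t/2) / (Real.exp (t/2) / 18) ^ (1 + ε) := by
        gcongr
    _ = _ := by
        rw [Real.div_rpow (Real.exp_pos _).le (by norm_num), ← Real.exp_mul, 
          show -(ε/2 * t) = t/2 - t/2 * (1 + ε) by ring, Real.exp_sub]
        have : (18:ℝ) ^ (1 + ε) ≠ 0 := by positivity
        field_simp

lemma jac_int_small {σ D : ℝ} (hσ0 : 0 < σ) (hσ1 : σ < 1) (hD : 0 < D) :
    ∫⁻ t in Ioi (0:ℝ), ENNReal.ofReal (t ^ σ / (t^2 + D^2)) ≤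
      ENNReal.ofReal ((1 + 1 / (1 - σ)) * D ^ (σ - 1)) := by
  have h1σ : 0 < 1 - σ := by linarith
  rw [← Ioc_union_Ioi_eq_Ioi hD.le]
  refine (lintegral_union_le _ _ _).trans ?_
  rw [add_mul, ENNReal.ofReal_add (by positivity) (by positivity)]
  refine add_le_add ?_ ?_
  · calc ∫⁻ t in Ioc 0 D, ENNReal.ofReal (t ^ σ / (t^2 + D^2)) 
        ≤ ∫⁻ t in Ioc 0 D, ENNReal.ofReal (D ^ σ / D^2) := by
          refine setLIntegral_mono' measurableSet_Ioc fun t ht => ENNReal.ofReal_le_ofReal ?_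
          have := ht.1
          gcongr
          · exact ht.2
          · nlinarith
      _ = _ := by
          rw [setLIntegral_const, Real.volume_Ioc, ← ENNReal.ofReal_mul (by positivity)]
          congr 1
          rw [Real.rpow_sub hD, Real.rpow_one]; field_simp; ring
  · calc ∫⁻ t in Ioi D, ENNReal.ofReal (t ^ σ / (t^2 + D^2)) 
        ≤ ∫⁻ t in Ioi D, ENNReal.ofReal (t ^ (σ - 2)) := by
          refine setLIntegral_mono' measurableSet_Ioi fun t ht => ENNReal.ofReal_le_ofReal ?_
          have ht0 : 0 < t := hD.trans ht
          rw [Real.rpow_sub ht0, Real.rpow_two]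
          gcongr
          nlinarith
      _ = _ := by
          rw [← ofReal_integral_eq_lintegral_ofReal (integrableOn_Ioi_rpow_of_lt (by linarith) hD),
            integral_Ioi_rpow_of_lt (by linarith) hD]
          · congr 1
            rw [show σ - 2 + 1 = σ - 1 by ring]
            have : σ - 1 ≠ 0 := by linarith
            field_simp
            ring
          · filter_upwards [ae_restrict_mem measurableSet_Ioi] with x hx
            have : (0:ℝ) < x := hD.trans hx
            simp only [Pi.zero_apply]
            positivity

lemma jac_frac {σ β₀ : ℝ} (hσ0 : 0 < σ) (hσ1 : σ < 1) (hβ₀ : -(1/2) < β₀) :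
    ∃ C : ℝ, 0 < C ∧ ∀ α β θ φ : ℝ, -(1/2) < α → β₀ ≤ β → θ ∈ Ioo 0 π → φ ∈ Ioo 0 π → θ ≠ φ →
      jacobiFracKernel σ α β θ φ ≤ C * |Real.sin ((θ - φ)/2)| ^ (σ - 1) *
      ((Real.sin (θ/2) * Real.sin (φ/2)) ^ (-(α + 1/2)) *
        (Real.cos (θ/2) * Real.cos (φ/2)) ^ (-(β + 1/2))) := by
  obtain ⟨ε, hε⟩ : ∃ ε, ε = (β₀ + 1/2)/2 := ⟨_, rfl⟩
  have hε0 : 0 < ε := by rw [hε]; linarith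
  have hGσ := Real.Gamma_pos_of_pos hσ0
  have hG1 := Real.Gamma_pos_of_pos hε0
  have hG2 := Real.Gamma_pos_of_pos (show 0 < 2 * ε by linarith)
  have hG3 := Real.Gamma_pos_of_pos (show 0 < 1 + ε by linarith)
  have h1σ : 0 < 1 - σ := by linarith
  obtain ⟨C₁, hC₁⟩ : ∃ C₁, C₁ = 8 * (Real.Gamma ε / Real.Gamma (2*ε)) * Real.Gamma (1 + ε) * 18 ^ (1 + ε) := ⟨_, rfl⟩
  have hC₁0 : 0 < C₁ := by rw [hC₁]; positivity
  refine ⟨1 / Real.Gamma σ * (64 * (1 + 1/(1-σ)) + C₁ * (1 / (ε/2))), by positivity, ?_⟩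
  intro α β θ φ hα hβ hθ hφ hne
  have hs1 : 0 < Real.sin (θ/2) := Real.sin_pos_of_pos_of_lt_pi (by linarith [hθ.1]) (by linarith [hθ.2, hθ.1])
  have hs2 : 0 < Real.sin (φ/2) := Real.sin_pos_of_pos_of_lt_pi (by linarith [hφ.1]) (by linarith [hφ.2, hφ.1])
  have hc1 : 0 < Real.cos (θ/2) := Real.cos_pos_of_mem_Ioo ⟨by linarith [hθ.1, hθ.2], by linarith [hθ.2]⟩
  have hc2 : 0 < Real.cos (φ/2) := Real.cos_pos_of_mem_Ioo ⟨by linarith [hφ.1, hφ.2], by linarith [hφ.2]⟩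
  obtain ⟨W, hW⟩ : ∃ W, W = ((Real.sin (θ/2) * Real.sin (φ/2)) ^ (-(α + 1/2)) *
        (Real.cos (θ/2) * Real.cos (φ/2)) ^ (-(β + 1/2))) := ⟨_, rfl⟩
  have hW0 : 0 < W := by rw [hW]; positivity
  have hDne : Real.sin ((θ - φ)/2) ≠ 0 := by
    intro h
    rw [Real.sin_eq_zero_iff_of_lt_of_lt (by linarith [hθ.1, hφ.2, Real.pi_pos]) (by linarith [hθ.2, hφ.1, Real.pi_pos])] at h
    exact hne (by linarith)
  obtain ⟨D, hD⟩ : ∃ D, D = |Real.sin ((θ - φ)/2)| := ⟨_, rfl⟩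
  have hD0 : 0 < D := by rw [hD]; positivity
  have hD1 : D ≤ 1 := by rw [hD]; exact Real.abs_sin_le_one _
  have hDσ : 1 ≤ D ^ (σ - 1) := Real.one_le_rpow_of_pos_of_le_one_of_nonpos hD0 hD1 (by linarith)
  rw [← hW, ← hD]
  have hρ : Real.Gamma (β + 1/2 - ε) / Real.Gamma (β + 1/2) ≤ Real.Gamma ε / Real.Gamma (2*ε) :=
    jac_gamma_ratio hε0 (by rw [hε]; linarith)
  have hpt : ∀ t ∈ Ioi (0:ℝ), jacobiPoissonKernel α β t θ φ * t ^ (σ - 1) ≤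
      W * (64 * (t ^ σ / (t^2 + D^2))) + W * (C₁ * (t ^ ((1:ℝ) - 1) * Real.exp (-(ε/2 * t)))) := by
    intro t ht
    have ht0 : (0:ℝ) < t := ht
    rcases le_total t 1 with h1 | h1
    · have hP := jac_poisson hα (show -(1/2) < β by linarith) le_rfl (by linarith) ht0 hθ hφ
      rw [sub_zero, div_self (Real.Gamma_pos_of_pos (show 0 < β + 1/2 by linarith)).ne', add_zero,
        Real.Gamma_one, Real.rpow_one, ← hW] at hP
      have hS := jac_small_t ht0 h1 hDne
      rw [← hD] at hS
      refine le_trans ?_ (le_add_of_nonneg_right (by positivity))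
      calc jacobiPoissonKernel α β t θ φ * t ^ (σ - 1) ≤ 
            (8 * 1 * 1 * (8 * t / (t^2 + D^2)) * W) * t ^ (σ - 1) := by
            gcongr
            exact hP.trans (by gcongr)
        _ = _ := by
            rw [Real.rpow_sub ht0, Real.rpow_one]; field_simp; ring
    · have hP := jac_poisson hα (show -(1/2) < β by linarith) hε0.le (by rw [hε]; linarith) ht0 hθ hφ
      rw [← hW] at hP
      have hL := jac_large_t h1 hε0.le (Real.cos_le_one ((θ - φ)/2))
      refine le_trans ?_ (le_add_of_nonneg_left (by positivity))
      have hG4 := Real.Gamma_pos_of_pos (show 0 < β + 1/2 by linarith)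
      have hG5 := Real.Gamma_pos_of_pos (show 0 < β + 1/2 - ε by rw [hε]; linarith)
      have hcosh : 1 ≤ Real.cosh (t/2) := Real.one_le_cosh _
      have hsinh : 0 < Real.sinh (t/2) := Real.sinh_pos_iff.2 (by positivity)
      have hX : 0 ≤ Real.sinh (t/2) / (Real.cosh (t/2) - Real.cos ((θ - φ)/2)) ^ (1 + ε) := 
        div_nonneg hsinh.le (Real.rpow_nonneg (by linarith [Real.cos_le_one ((θ - φ)/2)]) _)
      have ht1 : t ^ (σ - 1) ≤ 1 := Real.rpow_le_one_of_one_le_of_nonpos h1 (by linarith)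
      have hP2 : jacobiPoissonKernel α β t θ φ ≤ 8 * (Real.Gamma ε / Real.Gamma (2*ε)) * Real.Gamma (1 + ε) * 
          (18 ^ (1 + ε) * Real.exp (-(ε/2 * t))) * W := hP.trans (by gcongr)
      calc jacobiPoissonKernel α β t θ φ * t ^ (σ - 1) ≤ 8 * (Real.Gamma ε / Real.Gamma (2*ε)) * Real.Gamma (1 + ε) * 
          (18 ^ (1 + ε) * Real.exp (-(ε/2 * t))) * W * 1 := by
            gcongr
        _ = _ := by rw [hC₁]; simp; ring
  have hint : ENNReal.ofReal (∫ t in Ioi (0:ℝ), jacobiPoissonKernel α β t θ φ * t ^ (σ - 1)) ≤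
      ENNReal.ofReal ((64 * (1 + 1/(1-σ)) + C₁ * (1 / (ε/2))) * D ^ (σ - 1) * W) := by
    refine (jac_ofReal_integral_le _ _).trans ?_
    calc ∫⁻ t in Ioi (0:ℝ), ENNReal.ofReal (jacobiPoissonKernel α β t θ φ * t ^ (σ - 1)) 
        ≤ ∫⁻ t in Ioi (0:ℝ), (ENNReal.ofReal (W * 64) * ENNReal.ofReal (t ^ σ / (t^2 + D^2)) +
          ENNReal.ofReal (W * C₁) * ENNReal.ofReal (t ^ ((1:ℝ) - 1) * Real.exp (-(ε/2 * t)))) := by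
          refine setLIntegral_mono' measurableSet_Ioi fun t ht => ?_
          have ht0 : (0:ℝ) < t := ht
          rw [← ENNReal.ofReal_mul (by positivity), ← ENNReal.ofReal_mul (by positivity),
            ← ENNReal.ofReal_add (by positivity) (by positivity), mul_assoc, mul_assoc]
          exact ENNReal.ofReal_le_ofReal (hpt t ht)
      _ = ENNReal.ofReal (W * 64) * (∫⁻ t in Ioi (0:ℝ), ENNReal.ofReal (t ^ σ / (t^2 + D^2))) +
          ENNReal.ofReal (W * C₁) * ∫⁻ t in Ioi (0:ℝ), ENNReal.ofReal (t ^ ((1:ℝ) - 1) * Real.exp (-(ε/2 * t))) := by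
          rw [lintegral_add_left (by fun_prop), lintegral_const_mul' _ _ ENNReal.ofReal_ne_top,
            lintegral_const_mul' _ _ ENNReal.ofReal_ne_top]
      _ ≤ ENNReal.ofReal (W * 64) * ENNReal.ofReal ((1 + 1 / (1 - σ)) * D ^ (σ - 1)) +
          ENNReal.ofReal (W * C₁) * ENNReal.ofReal ((1 / (ε/2)) ^ (1:ℝ) * Real.Gamma 1) := by
          rw [jac_lintegral_gamma one_pos (by positivity)]
          gcongr
          exact jac_int_small hσ0 hσ1 hD0
      _ ≤ _ := by
          rw [← ENNReal.ofReal_mul (by positivity), ← ENNReal.ofReal_mul (by positivity),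
            ← ENNReal.ofReal_add (by positivity) (by simp; positivity)]
          apply ENNReal.ofReal_le_ofReal
          rw [Real.rpow_one, Real.Gamma_one]
          have : W * C₁ * (1 / (ε/2) * 1) ≤ W * C₁ * (1 / (ε/2)) * D ^ (σ - 1) := by
            rw [mul_one]
            exact le_mul_of_one_le_right (by positivity) hDσ
          nlinarith
  have hint2 := (ENNReal.ofReal_le_ofReal_iff (by positivity)).1 hint
  unfold jacobiFracKernel
  calc _ ≤ 1 / Real.Gamma σ * ((64 * (1 + 1/(1-σ)) + C₁ * (1 / (ε/2))) * D ^ (σ - 1) * W) := by gcongr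
    _ = _ := by ring


noncomputable def jacX (s : ℝ) : ℝ := Real.sin (Real.arctan (Real.exp s))

noncomputable def jacY (s : ℝ) : ℝ := Real.cos (Real.arctan (Real.exp s))

lemma jacY_pos (s : ℝ) : 0 < jacY s := Real.cos_arctan_pos _

lemma jacX_eq (s : ℝ) : jacX s = Real.exp s * jacY s := by
  unfold jacX jacY
  rw [Real.sin_arctan, Real.cos_arctan]
  ring

lemma jacX_pos (s : ℝ) : 0 < jacX s := by
  rw [jacX_eq]
  exact mul_pos (Real.exp_pos s) (jacY_pos s)

lemma jacX_le_one (s : ℝ) : jacX s ≤ 1 := Real.sin_le_one _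

lemma jacY_le_one (s : ℝ) : jacY s ≤ 1 := Real.cos_le_one _

lemma jac_arctan_mem (s : ℝ) : Real.arctan (Real.exp s) ∈ Ioo 0 (π/2) :=
  ⟨Real.arctan_pos.2 (Real.exp_pos s), Real.arctan_lt_pi_div_two _⟩

lemma jacX_mono {s t : ℝ} (h : s ≤ t) : jacX s ≤ jacX t := by
  have h1 := jac_arctan_mem s
  have h2 := jac_arctan_mem t
  apply Real.sin_le_sin_of_le_of_le_pi_div_two
  · linarith [h1.1, Real.pi_pos]
  · exact h2.2.le
  · exact Real.arctan_strictMono.monotone (Real.exp_le_exp.2 h)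

lemma jacY_anti {s t : ℝ} (h : s ≤ t) : jacY t ≤ jacY s := by
  have h1 := jac_arctan_mem s
  have h2 := jac_arctan_mem t
  apply Real.cos_le_cos_of_nonneg_of_le_pi
  · exact h1.1.le
  · linarith [h2.2, Real.pi_pos]
  · exact Real.arctan_strictMono.monotone (Real.exp_le_exp.2 h)

lemma jac_cont : Continuous jacX ∧ Continuous jacY := by
  unfold jacX jacY
  constructor
  · exact Real.continuous_sin.comp (Real.continuous_arctan.comp Real.continuous_exp)
  · exact Real.continuous_cos.comp (Real.continuous_arctan.comp Real.continuous_exp)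

lemma jac_deriv (s : ℝ) : HasDerivAt (fun s => 2 * Real.arctan (Real.exp s))
    (2 * (jacX s * jacY s)) s := by
  have h := ((Real.hasDerivAt_exp s).arctan).const_mul 2
  refine h.congr_deriv ?_
  rw [jacX_eq]
  have : jacY s ^ 2 = 1 / (1 + Real.exp s ^ 2) := Real.cos_sq_arctan _
  rw [← this]; ring

lemma jac_image : (fun s => 2 * Real.arctan (Real.exp s)) '' univ = Ioo 0 π := by
  ext x
  constructor
  · rintro ⟨s, -, rfl⟩
    have := jac_arctan_mem s
    constructor
    · show 0 < 2 * Real.arctan (Real.exp s)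
      linarith [this.1]
    · show 2 * Real.arctan (Real.exp s) < π
      linarith [this.2]
  · rintro ⟨h0, h1⟩
    refine ⟨Real.log (Real.tan (x/2)), trivial, ?_⟩
    have ht : 0 < Real.tan (x/2) := Real.tan_pos_of_pos_of_lt_pi_div_two (by linarith) (by linarith)
    show 2 * Real.arctan (Real.exp (Real.log (Real.tan (x/2)))) = x
    rw [Real.exp_log ht, Real.arctan_tan (by linarith) (by linarith)]
    ring

lemma jac_inj : InjOn (fun s => 2 * Real.arctan (Real.exp s)) univ := by
  intro s _ t _ h
  have h' : 2 * Real.arctan (Real.exp s) = 2 * Real.arctan (Real.exp t) := h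
  exact Real.exp_injective (Real.arctan_injective (by linarith))

lemma jac_dens_meas (α β : ℝ) : Measurable (fun θ : ℝ =>
    ENNReal.ofReal ((Real.sin (θ/2)) ^ (2*α+1) * (Real.cos (θ/2)) ^ (2*β+1))) := by
  fun_prop

lemma jac_lint (α β : ℝ) (G : ℝ → ℝ≥0∞) :
    ∫⁻ θ, G θ ∂jacobiMeasure α β = ∫⁻ θ in Ioo (0:ℝ) π,
      ENNReal.ofReal ((Real.sin (θ/2)) ^ (2*α+1) * (Real.cos (θ/2)) ^ (2*β+1)) * G θ := by
  unfold jacobiMeasure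
  rw [lintegral_withDensity_eq_lintegral_mul_non_measurable _ (jac_dens_meas α β)
    (Filter.Eventually.of_forall fun _ => ENNReal.ofReal_lt_top)]
  rfl

lemma jac_cov (α β : ℝ) (G : ℝ → ℝ≥0∞) :
    ∫⁻ θ, G θ ∂jacobiMeasure α β = ∫⁻ s,
      ENNReal.ofReal (2 * (jacX s ^ (2*α+2) * jacY s ^ (2*β+2))) *
        G (2 * Real.arctan (Real.exp s)) := by
  rw [jac_lint, ← jac_image, lintegral_image_eq_lintegral_abs_deriv_mul MeasurableSet.univ
    (fun s _ => (jac_deriv s).hasDerivWithinAt) jac_inj, setLIntegral_univ]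
  apply lintegral_congr
  intro s
  have hx := jacX_pos s
  have hy := jacY_pos s
  rw [← mul_assoc, ← ENNReal.ofReal_mul (abs_nonneg _)]
  congr 2
  rw [abs_of_pos (by positivity)]
  have e : 2 * Real.arctan (Real.exp s) / 2 = Real.arctan (Real.exp s) := by ring
  rw [e]
  change 2 * (jacX s * jacY s) * (jacX s ^ (2*α+1) * jacY s ^ (2*β+1)) = _
  have e1 : jacX s ^ (2*α+2) = jacX s ^ (2*α+1) * jacX s := by
    rw [← Real.rpow_add_one hx.ne']; congr 1; ring
  have e2 : jacY s ^ (2*β+2) = jacY s ^ (2*β+1) * jacY s := by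
    rw [← Real.rpow_add_one hy.ne']; congr 1; ring
  rw [e1, e2]; ring

lemma jac_ker_alg {x1 x2 y1 y2 A A' B B' κ δ : ℝ} (hx2 : 0 < x2) (hx : x2 ≤ x1) (hx1 : x1 ≤ 1)
    (hy1 : 0 < y1) (hy : y1 ≤ y2) (hy2 : y2 ≤ 1) (hr : x2*y1/(x1*y2) < 1)
    (hAB : κ ≤ A + B) (hAB' : κ ≤ A' + B') (hB : δ ≤ B) (hA' : δ ≤ A') :
    x1^A * y1^A' * (x2^B * y2^B') * (x1*y2 - y1*x2)^(-κ) ≤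
      (x2*y1/(x1*y2))^δ * (1 - x2*y1/(x1*y2))^(-κ) := by
  have hx1p : 0 < x1 := hx2.trans_le hx
  have hy2p : 0 < y2 := hy1.trans_le hy
  have e0 : x1*y2 - y1*x2 = x1 * y2 * (1 - x2*y1/(x1*y2)) := by
    field_simp
  rw [e0, Real.mul_rpow (by positivity) (by linarith), ← mul_assoc]
  apply mul_le_mul_of_nonneg_right _ (Real.rpow_nonneg (by linarith) _)
  rw [Real.mul_rpow hx1p.le hy2p.le]
  have key : ∀ a b P Q : ℝ, 0 < b → b ≤ a → a ≤ 1 → κ ≤ P + Q → δ ≤ Q →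
      a^P * b^Q * a^(-κ) ≤ (b/a)^δ := by
    intro a b P Q hb hba ha h1 h2
    have hap : 0 < a := hb.trans_le hba
    have e : a^P * b^Q * a^(-κ) = a^(P+Q-κ) * (b/a)^Q := by
      rw [Real.div_rpow hb.le hap.le, Real.rpow_sub hap, Real.rpow_add hap, Real.rpow_neg hap.le]
      field_simp
    rw [e]
    calc a^(P+Q-κ) * (b/a)^Q ≤ 1 * (b/a)^Q := by
          apply mul_le_mul_of_nonneg_right _ (by positivity)
          exact Real.rpow_le_one hap.le ha (by linarith)
      _ = (b/a)^Q := one_mul _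
      _ ≤ (b/a)^δ := Real.rpow_le_rpow_of_exponent_ge (by positivity)
          ((div_le_one hap).2 hba) h2
  have k1 := key x1 x2 A B hx2 hx hx1 hAB hB
  have k2 := key y2 y1 B' A' hy1 hy hy2 (by linarith) hA'
  calc x1^A * y1^A' * (x2^B * y2^B') * (x1^(-κ) * y2^(-κ))
      = (x1^A * x2^B * x1^(-κ)) * (y2^B' * y1^A' * y2^(-κ)) := by ring
    _ ≤ (x2/x1)^δ * (y1/y2)^δ := mul_le_mul k1 k2 (by positivity) (by positivity)
    _ = _ := by
      rw [← Real.mul_rpow (by positivity) (by positivity)]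
      congr 1
      field_simp

lemma jac_ratio (s t : ℝ) : jacX t * jacY s / (jacX s * jacY t) = Real.exp (-(s-t)) := by
  rw [jacX_eq, jacX_eq, show -(s-t) = t - s by ring, Real.exp_sub]
  have := (jacY_pos s).ne'
  have := (jacY_pos t).ne'
  have := (Real.exp_pos s).ne'
  field_simp

lemma jac_ker_bound {A A' B B' κ δ : ℝ}
    (hAB : κ ≤ A + B) (hAB' : κ ≤ A' + B') (hA : δ ≤ A) (hB : δ ≤ B) (hA' : δ ≤ A')
    (hB' : δ ≤ B') {s t : ℝ} (hst : s ≠ t) :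
    jacX s^A * jacY s^A' * (jacX t^B * jacY t^B') * |jacX s * jacY t - jacY s * jacX t|^(-κ) ≤
      Real.exp (-(δ*|s-t|)) * (1 - Real.exp (-|s-t|))^(-κ) := by
  have main : ∀ {A A' B B' s t : ℝ}, κ ≤ A + B → κ ≤ A' + B' → δ ≤ B → δ ≤ A' → t < s →
      jacX s^A * jacY s^A' * (jacX t^B * jacY t^B') * |jacX s * jacY t - jacY s * jacX t|^(-κ) ≤
      Real.exp (-(δ*|s-t|)) * (1 - Real.exp (-|s-t|))^(-κ) := by
    intro A A' B B' s t hAB hAB' hB hA' hst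
    have hr := jac_ratio s t
    have hlt : Real.exp (-(s-t)) < 1 := by rw [Real.exp_lt_one_iff]; linarith
    have := jac_ker_alg (x1 := jacX s) (x2 := jacX t) (y1 := jacY s) (y2 := jacY t)
      (jacX_pos t) (jacX_mono hst.le) (jacX_le_one s) (jacY_pos s) (jacY_anti hst.le)
      (jacY_le_one t) (by rw [hr]; exact hlt) hAB hAB' hB hA'
    rw [hr, ← Real.exp_mul] at this
    have hpos : 0 ≤ jacX s * jacY t - jacY s * jacX t := by
      rw [div_eq_iff (mul_pos (jacX_pos s) (jacY_pos t)).ne'] at hr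
      have := mul_pos (jacX_pos s) (jacY_pos t)
      nlinarith
    rw [abs_of_nonneg hpos, abs_of_pos (show 0 < s - t by linarith)]
    rwa [show -(s-t)*δ = -(δ*(s-t)) by ring] at this
  rcases lt_or_gt_of_ne hst with h | h
  · have := main (A := B) (A' := B') (B := A) (B' := A') (s := t) (t := s) (by linarith)
      (by linarith) hA hB' h
    rw [abs_sub_comm s t]
    refine le_trans (le_of_eq ?_) this
    rw [show |jacX s * jacY t - jacY s * jacX t| = |jacX t * jacY s - jacY t * jacX s| by
      rw [abs_sub_comm]; congr 1; ring]
    ring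
  · exact main hAB hAB' hB hA' h


lemma jac_k_pt {δ κ r s : ℝ} (hκ : 0 < κ) (hr : 0 < r) (hs : 0 < s) :
    (Real.exp (-(δ*s)) * (1 - Real.exp (-s))^(-κ))^r ≤
      2^(κ*r) * (s^((1:ℝ)-1) * Real.exp (-((δ*r)*s))) +
      2^(κ*r) * (s^((1-κ*r)-1) * Real.exp (-((δ*r)*s))) := by
  have h1 : 0 < 1 - Real.exp (-s) := by
    have : Real.exp (-s) < 1 := by rw [Real.exp_lt_one_iff]; linarith
    linarith
  have h2 : s/(1+s) ≤ 1 - Real.exp (-s) := by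
    have : Real.exp (-s) ≤ 1/(1+s) := by
      rw [Real.exp_neg, ← one_div]
      apply one_div_le_one_div_of_le (by linarith)
      linarith [Real.add_one_le_exp s]
    have e : s/(1+s) = 1 - 1/(1+s) := by field_simp; ring
    linarith
  have hη : 0 < κ*r := mul_pos hκ hr
  rw [Real.mul_rpow (Real.exp_pos _).le (Real.rpow_nonneg h1.le _), ← Real.exp_mul,
    ← Real.rpow_mul h1.le, show -(δ*s)*r = -((δ*r)*s) by ring, sub_self, Real.rpow_zero,
    show -κ*r = -(κ*r) by ring, show 1-κ*r-1 = -(κ*r) by ring]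
  have h3 : (1 - Real.exp (-s))^(-(κ*r)) ≤ (s/(1+s))^(-(κ*r)) :=
    Real.rpow_le_rpow_of_nonpos (by positivity) h2 (by linarith)
  have h4 : (s/(1+s))^(-(κ*r)) ≤ 2^(κ*r) + 2^(κ*r) * s^(-(κ*r)) := by
    rw [Real.rpow_neg (by positivity), ← Real.inv_rpow (by positivity), inv_div]
    have hsn : 0 < s^(-(κ*r)) := by positivity
    have h2p : (0:ℝ) < 2^(κ*r) := by positivity
    rcases le_total 1 s with h | h
    · have : ((1+s)/s)^(κ*r) ≤ 2^(κ*r) := by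
        apply Real.rpow_le_rpow (by positivity) _ hη.le
        rw [div_le_iff₀ hs]; linarith
      nlinarith
    · have : ((1+s)/s)^(κ*r) ≤ (2 * s⁻¹)^(κ*r) := by
        apply Real.rpow_le_rpow (by positivity) _ hη.le
        rw [div_eq_mul_inv]
        apply mul_le_mul_of_nonneg_right (by linarith) (by positivity)
      rw [Real.mul_rpow (by norm_num) (by positivity), Real.inv_rpow hs.le,
        ← Real.rpow_neg hs.le] at this
      linarith
  have he := Real.exp_pos (-((δ*r)*s))
  nlinarith [h3.trans h4]

lemma jac_k_int {δ κ r : ℝ} (hδ : 0 < δ) (hκ : 0 < κ) (hr : 0 < r) (hκr : κ*r < 1) :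
    ∫⁻ s, (ENNReal.ofReal (Real.exp (-(δ*|s|)) * (1 - Real.exp (-|s|))^(-κ)))^r < ∞ := by
  set k : ℝ → ℝ≥0∞ := fun s =>
    (ENNReal.ofReal (Real.exp (-(δ*|s|)) * (1 - Real.exp (-|s|))^(-κ)))^r with hk
  have hpos : ∫⁻ s in Ioi 0, k s < ∞ := by
    calc ∫⁻ s in Ioi 0, k s ≤ ∫⁻ s in Ioi 0,
          (ENNReal.ofReal (2^(κ*r)) * ENNReal.ofReal (s^((1:ℝ)-1) * Real.exp (-((δ*r)*s))) +
          ENNReal.ofReal (2^(κ*r)) *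
            ENNReal.ofReal (s^((1-κ*r)-1) * Real.exp (-((δ*r)*s)))) := by
          apply setLIntegral_mono' measurableSet_Ioi
          intro s hs
          have hs' : 0 < s := hs
          rw [hk]
          simp only
          rw [abs_of_pos hs']
          have h1 : 0 < 1 - Real.exp (-s) := by
            have : Real.exp (-s) < 1 := by rw [Real.exp_lt_one_iff]; linarith
            linarith
          rw [ENNReal.ofReal_rpow_of_nonneg (by positivity) hr.le,
            ← ENNReal.ofReal_mul (by positivity), ← ENNReal.ofReal_mul (by positivity),
            ← ENNReal.ofReal_add (by positivity) (by positivity)]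
          exact ENNReal.ofReal_le_ofReal (jac_k_pt hκ hr hs')
      _ < ∞ := by
          rw [lintegral_add_left (by fun_prop), lintegral_const_mul _ (by fun_prop),
            lintegral_const_mul _ (by fun_prop), jac_lintegral_gamma one_pos (by positivity),
            jac_lintegral_gamma (by linarith) (by positivity)]
          exact ENNReal.add_lt_top.2 ⟨ENNReal.mul_lt_top ENNReal.ofReal_lt_top
            ENNReal.ofReal_lt_top, ENNReal.mul_lt_top ENNReal.ofReal_lt_top
            ENNReal.ofReal_lt_top⟩
  have hneg : ∫⁻ s in Iio 0, k s < ∞ := by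
    have e : ∫⁻ s in Iio 0, k s = ∫⁻ s in Ioi 0, k s := by
      rw [← lintegral_indicator measurableSet_Iio, ← lintegral_indicator measurableSet_Ioi,
        ← lintegral_neg_eq_self]
      apply lintegral_congr
      intro s
      simp [indicator, hk]
    rw [e]; exact hpos
  rw [← lintegral_add_compl _ (measurableSet_Ioi (a := (0:ℝ)))]
  refine ENNReal.add_lt_top.2 ⟨hpos, ?_⟩
  rw [compl_Ioi, ← setLIntegral_congr (Iio_ae_eq_Iic (a := (0:ℝ)) (μ := volume))]
  exact hneg


noncomputable def jacKer (σ α β θ φ : ℝ) : ℝ :=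
  |Real.sin ((θ-φ)/2)|^(σ-1) * ((Real.sin (θ/2) * Real.sin (φ/2))^(-(α+1/2)) *
    (Real.cos (θ/2) * Real.cos (φ/2))^(-(β+1/2)))

lemma jacKer_meas (σ α β : ℝ) : Measurable (fun x : ℝ × ℝ => jacKer σ α β x.1 x.2) := by
  unfold jacKer
  fun_prop

lemma jacKer_meas' (σ α β θ : ℝ) : Measurable (fun φ : ℝ => jacKer σ α β θ φ) := by
  unfold jacKer
  fun_prop

lemma jac_w_ker {σ α β p q δ : ℝ} (hp0 : 0 < p) (hpq : p ≤ q)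
    (hAB : 1-σ ≤ ((2*α+2)*(1/q) - (α+1/2)) + ((2*α+2)*(1-1/p) - (α+1/2)))
    (hAB' : 1-σ ≤ ((2*β+2)*(1/q) - (β+1/2)) + ((2*β+2)*(1-1/p) - (β+1/2)))
    (hA : δ ≤ (2*α+2)*(1/q) - (α+1/2)) (hB : δ ≤ (2*α+2)*(1-1/p) - (α+1/2))
    (hA' : δ ≤ (2*β+2)*(1/q) - (β+1/2)) (hB' : δ ≤ (2*β+2)*(1-1/p) - (β+1/2))
    {s t : ℝ} (hst : s ≠ t) :
    (2 * (jacX s ^ (2*α+2) * jacY s ^ (2*β+2)))^(1/q) *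
      (2 * (jacX t ^ (2*α+2) * jacY t ^ (2*β+2)))^(1-1/p) *
      jacKer σ α β (2 * Real.arctan (Real.exp s)) (2 * Real.arctan (Real.exp t)) ≤
    2 * (Real.exp (-(δ*|s-t|)) * (1 - Real.exp (-|s-t|))^(-(1-σ))) := by
  have hb := jac_ker_bound (κ := 1-σ) hAB hAB' hA hB hA' hB' hst
  have hxs := jacX_pos s
  have hxt := jacX_pos t
  have hys := jacY_pos s
  have hyt := jacY_pos t
  have hsin : Real.sin ((2 * Real.arctan (Real.exp s) - 2 * Real.arctan (Real.exp t))/2) =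
      jacX s * jacY t - jacY s * jacX t := by
    rw [show (2 * Real.arctan (Real.exp s) - 2 * Real.arctan (Real.exp t))/2 =
      Real.arctan (Real.exp s) - Real.arctan (Real.exp t) by ring, Real.sin_sub]
    rfl
  have e : ∀ s : ℝ, 2 * Real.arctan (Real.exp s) / 2 = Real.arctan (Real.exp s) := by
    intro s; ring
  unfold jacKer
  rw [hsin, e, e]
  change _ * (_ * ((jacX s * jacX t)^(-(α+1/2)) * (jacY s * jacY t)^(-(β+1/2)))) ≤ _
  rw [Real.mul_rpow (by norm_num) (by positivity), Real.mul_rpow (by positivity) (by positivity),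
    Real.mul_rpow (by norm_num) (by positivity), Real.mul_rpow (by positivity) (by positivity),
    Real.mul_rpow hxs.le hxt.le, Real.mul_rpow hys.le hyt.le,
    ← Real.rpow_mul hxs.le, ← Real.rpow_mul hxt.le, ← Real.rpow_mul hys.le, ← Real.rpow_mul hyt.le]
  rw [sub_eq_add_neg, Real.rpow_add hxs, sub_eq_add_neg ((2*α+2)*(1-1/p)), Real.rpow_add hxt,
    sub_eq_add_neg ((2*β+2)*(1/q)), Real.rpow_add hys, sub_eq_add_neg ((2*β+2)*(1-1/p)),
    Real.rpow_add hyt] at hb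
  have h2 : (2:ℝ)^(1/q) * 2^(1-1/p) ≤ 2 := by
    rw [← Real.rpow_add (by norm_num)]
    calc (2:ℝ)^(1/q + (1-1/p)) ≤ 2^(1:ℝ) := by
          apply Real.rpow_le_rpow_of_exponent_le (by norm_num)
          have := one_div_le_one_div_of_le hp0 hpq
          linarith
      _ = 2 := Real.rpow_one 2
  have := mul_le_mul h2 hb (by positivity) (by norm_num)
  refine le_trans (le_of_eq ?_) this
  rw [show σ - 1 = -(1-σ) by ring]
  ring

lemma jac_scalar {σ α β p q : ℝ} (hσ0 : 0 < σ) (hσ1 : σ < 1) (hα : -(1/2) < α)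
    (hβ : -(1/2) < β) (hp1 : 1 ≤ p) (hpq : p ≤ q)
    (hAB : 1-σ ≤ ((2*α+2)*(1/q) - (α+1/2)) + ((2*α+2)*(1-1/p) - (α+1/2)))
    (hAB' : 1-σ ≤ ((2*β+2)*(1/q) - (β+1/2)) + ((2*β+2)*(1-1/p) - (β+1/2)))
    (hA : 0 < (2*α+2)*(1/q) - (α+1/2)) (hB : 0 < (2*α+2)*(1-1/p) - (α+1/2))
    (hA' : 0 < (2*β+2)*(1/q) - (β+1/2)) (hB' : 0 < (2*β+2)*(1-1/p) - (β+1/2)) :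
    ∃ C : ℝ, 0 < C ∧ ∀ F : ℝ → ℝ≥0∞, Measurable F →
      (∫⁻ θ, (∫⁻ φ, ENNReal.ofReal (jacKer σ α β θ φ) * F φ ∂jacobiMeasure α β)^q
        ∂jacobiMeasure α β)^(1/q) ≤
      ENNReal.ofReal C * (∫⁻ θ, F θ^p ∂jacobiMeasure α β)^(1/p) := by
  obtain ⟨δ, hδ, h1, h2, h3, h4⟩ : ∃ δ : ℝ, 0 < δ ∧ δ ≤ (2*α+2)*(1/q) - (α+1/2) ∧
      δ ≤ (2*α+2)*(1-1/p) - (α+1/2) ∧ δ ≤ (2*β+2)*(1/q) - (β+1/2) ∧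
      δ ≤ (2*β+2)*(1-1/p) - (β+1/2) :=
    ⟨min (min _ _) (min _ _), lt_min (lt_min hA hB) (lt_min hA' hB'),
      (min_le_left _ _).trans (min_le_left _ _), (min_le_left _ _).trans (min_le_right _ _),
      (min_le_right _ _).trans (min_le_left _ _), (min_le_right _ _).trans (min_le_right _ _)⟩
  have hp0 : 0 < p := by linarith
  have hq0 : 0 < q := by linarith
  have hle := one_div_le_one_div_of_le hp0 hpq
  have hp1' : 1/p ≤ 1 := by rw [div_le_one hp0]; exact hp1
  have hq1' : 0 < 1/q := by positivity
  set r : ℝ := 1/(1+1/q-1/p) with hr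
  have hd : 0 < 1+1/q-1/p := by linarith
  have hr1 : 1 ≤ r := by rw [hr, le_div_iff₀ hd]; linarith
  have hr0 : 0 < r := by linarith
  have hr' : 1/r = 1+1/q-1/p := by rw [hr, one_div_one_div]
  have hκr : (1-σ)*r < 1 := by
    rw [hr, mul_one_div, div_lt_one hd]
    nlinarith
  set k0 : ℝ → ℝ := fun s => Real.exp (-(δ*|s|)) * (1 - Real.exp (-|s|))^(-(1-σ)) with hk0
  have hfin := jac_k_int hδ (show 0 < 1-σ by linarith) hr0 hκr
  set k : ℝ → ℝ≥0∞ := fun s => 2 * ENNReal.ofReal (k0 s) with hk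
  have hkm : Measurable k := by
    have : Measurable k0 := by
      rw [hk0]
      have : Measurable (fun s : ℝ => |s|) := continuous_abs.measurable
      fun_prop
    rw [hk]; fun_prop
  have hkfin : ∫⁻ s, k s^r < ∞ := by
    have : ∀ s, k s^r = 2^r * (ENNReal.ofReal (k0 s))^r := fun s =>
      ENNReal.mul_rpow_of_nonneg _ _ hr0.le
    simp_rw [this]
    rw [lintegral_const_mul' _ _ (ENNReal.rpow_ne_top_of_nonneg hr0.le (by norm_num))]
    exact ENNReal.mul_lt_top (ENNReal.rpow_lt_top_of_nonneg hr0.le (by norm_num)) hfin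
  have hKfin : (∫⁻ s, k s^r)^(1/r) ≠ ∞ := ENNReal.rpow_ne_top_of_nonneg (by positivity) hkfin.ne
  refine ⟨((∫⁻ s, k s^r)^(1/r)).toReal + 1, by positivity, fun F hF => ?_⟩
  set w : ℝ → ℝ := fun s => 2 * (jacX s ^ (2*α+2) * jacY s ^ (2*β+2)) with hw
  have hwpos : ∀ s, 0 < w s := by
    intro s
    have := jacX_pos s
    have := jacY_pos s
    simp only [hw]; positivity
  have hwm : Measurable w := by
    have := jac_cont.1.measurable
    have := jac_cont.2.measurable
    rw [hw]; fun_prop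
  set Θ : ℝ → ℝ := fun s => 2 * Real.arctan (Real.exp s) with hΘ
  have hΘm : Measurable Θ := by
    rw [hΘ]; exact (Real.continuous_arctan.comp Real.continuous_exp).measurable.const_mul 2
  set g : ℝ → ℝ≥0∞ := fun t => ENNReal.ofReal (w t)^(1/p) * F (Θ t) with hg
  have hgm : Measurable g := by
    have : Measurable (fun t => F (Θ t)) := hF.comp hΘm
    rw [hg]; fun_prop
  have hy := jac_young k g hkm hgm hp0 hpq hr1 hr' hp1
  have hgp : ∫⁻ t, g t^p = ∫⁻ θ, F θ^p ∂jacobiMeasure α β := by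
    rw [jac_cov]
    apply lintegral_congr
    intro t
    simp only [hg]
    rw [ENNReal.mul_rpow_of_nonneg _ _ hp0.le, ← ENNReal.rpow_mul, one_div,
      inv_mul_cancel₀ hp0.ne', ENNReal.rpow_one]
  have hlhs : ∫⁻ θ, (∫⁻ φ, ENNReal.ofReal (jacKer σ α β θ φ) * F φ ∂jacobiMeasure α β)^q
        ∂jacobiMeasure α β ≤ ∫⁻ s, (∫⁻ t, k (s-t) * g t)^q := by
    rw [jac_cov]
    apply lintegral_mono
    intro s
    change ENNReal.ofReal (w s) * (∫⁻ φ, ENNReal.ofReal (jacKer σ α β (Θ s) φ) * F φ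
      ∂jacobiMeasure α β)^q ≤ (∫⁻ t, k (s-t) * g t)^q
    have e : ENNReal.ofReal (w s) = (ENNReal.ofReal (w s)^(1/q))^q := by
      rw [← ENNReal.rpow_mul, one_div, inv_mul_cancel₀ hq0.ne', ENNReal.rpow_one]
    rw [e, ← ENNReal.mul_rpow_of_nonneg _ _ hq0.le]
    apply ENNReal.rpow_le_rpow _ hq0.le
    rw [jac_cov, ← lintegral_const_mul' _ _ (ENNReal.rpow_ne_top_of_nonneg (by positivity)
      ENNReal.ofReal_ne_top)]
    apply lintegral_mono_ae
    have hne : ∀ᵐ t : ℝ, t ≠ s := by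
      rw [ae_iff]; simp
    filter_upwards [hne] with t ht
    change ENNReal.ofReal (w s)^(1/q) * (ENNReal.ofReal (w t) *
      (ENNReal.ofReal (jacKer σ α β (Θ s) (Θ t)) * F (Θ t))) ≤
      2 * ENNReal.ofReal (k0 (s-t)) * (ENNReal.ofReal (w t)^(1/p) * F (Θ t))
    have hb := jac_w_ker hp0 hpq hAB hAB' h1 h2 h3 h4 ht.symm
    have e2 : ENNReal.ofReal (w t) =
        ENNReal.ofReal (w t^(1-1/p)) * ENNReal.ofReal (w t)^(1/p) := by
      rw [ENNReal.ofReal_rpow_of_pos (hwpos t),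
        ← ENNReal.ofReal_mul (Real.rpow_nonneg (hwpos t).le _), ← Real.rpow_add (hwpos t),
        sub_add_cancel, Real.rpow_one]
    have e3 : ENNReal.ofReal (w s)^(1/q) * ENNReal.ofReal (w t^(1-1/p)) *
        ENNReal.ofReal (jacKer σ α β (Θ s) (Θ t)) ≤ 2 * ENNReal.ofReal (k0 (s-t)) := by
      rw [ENNReal.ofReal_rpow_of_pos (hwpos s),
        ← ENNReal.ofReal_mul (Real.rpow_nonneg (hwpos s).le _),
        ← ENNReal.ofReal_mul (mul_nonneg (Real.rpow_nonneg (hwpos s).le _)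
          (Real.rpow_nonneg (hwpos t).le _)),
        show (2:ℝ≥0∞) = ENNReal.ofReal 2 by simp, ← ENNReal.ofReal_mul (by norm_num)]
      exact ENNReal.ofReal_le_ofReal hb
    calc _ = ENNReal.ofReal (w s)^(1/q) * (ENNReal.ofReal (w t^(1-1/p)) *
          ENNReal.ofReal (w t)^(1/p) *
          (ENNReal.ofReal (jacKer σ α β (Θ s) (Θ t)) * F (Θ t))) := by rw [← e2]
      _ = ENNReal.ofReal (w s)^(1/q) * ENNReal.ofReal (w t^(1-1/p)) *
          ENNReal.ofReal (jacKer σ α β (Θ s) (Θ t)) * (ENNReal.ofReal (w t)^(1/p) * F (Θ t)) := by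
          ring
      _ ≤ _ := by gcongr
  calc _ ≤ (∫⁻ s, (∫⁻ t, k (s-t) * g t)^q)^(1/q) := ENNReal.rpow_le_rpow hlhs (by positivity)
    _ ≤ _ := hy
    _ ≤ _ := by
      rw [hgp]
      apply mul_le_mul_left
      rw [ENNReal.le_ofReal_iff_toReal_le hKfin (by positivity)]
      linarith


lemma jac_Tj_pt {σ α β m n C K θ φ : ℝ}
    (hθ : θ ∈ Ioo 0 π) (hφ : φ ∈ Ioo 0 π)
    (hK : K ≤ C * |Real.sin ((θ-φ)/2)|^(σ-1) *
      ((Real.sin (θ/2) * Real.sin (φ/2))^(-(α+m+1/2)) *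
        (Real.cos (θ/2) * Real.cos (φ/2))^(-(β+n+1/2)))) (hC : 0 < C) (x : ℝ≥0∞) :
    ENNReal.ofReal ((Real.sin (θ/2))^m * (Real.cos (θ/2))^n) *
      (ENNReal.ofReal ((Real.sin (φ/2)) ^ (2*(α+m)+1) * (Real.cos (φ/2)) ^ (2*(β+n)+1)) *
      (ENNReal.ofReal K * (ENNReal.ofReal ((Real.sin (φ/2))^m * (Real.cos (φ/2))^n))⁻¹ * x)) ≤
    ENNReal.ofReal ((Real.sin (φ/2)) ^ (2*α+1) * (Real.cos (φ/2)) ^ (2*β+1)) *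
      (ENNReal.ofReal C * ENNReal.ofReal (jacKer σ α β θ φ) * x) := by
  have s1 : 0 < Real.sin (θ/2) := Real.sin_pos_of_pos_of_lt_pi (by linarith [hθ.1])
    (by linarith [hθ.2, Real.pi_pos])
  have s2 : 0 < Real.sin (φ/2) := Real.sin_pos_of_pos_of_lt_pi (by linarith [hφ.1])
    (by linarith [hφ.2, Real.pi_pos])
  have c1 : 0 < Real.cos (θ/2) := Real.cos_pos_of_mem_Ioo
    ⟨by linarith [hθ.1, Real.pi_pos], by linarith [hθ.2]⟩
  have c2 : 0 < Real.cos (φ/2) := Real.cos_pos_of_mem_Ioo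
    ⟨by linarith [hφ.1, Real.pi_pos], by linarith [hφ.2]⟩
  unfold jacKer
  generalize Real.sin (θ/2) = a at *
  generalize Real.sin (φ/2) = b at *
  generalize Real.cos (θ/2) = c at *
  generalize Real.cos (φ/2) = d at *
  generalize hD : |Real.sin ((θ-φ)/2)|^(σ-1) = D at *
  have hD0 : 0 ≤ D := by rw [← hD]; positivity
  have key : (a^m*c^n) * ((b^(2*(α+m)+1) * d^(2*(β+n)+1)) * (K * (b^m*d^n)⁻¹)) ≤
      (b^(2*α+1) * d^(2*β+1)) * (C * (D * ((a*b)^(-(α+1/2)) * (c*d)^(-(β+1/2))))) := by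
    calc _ ≤ (a^m*c^n) * ((b^(2*(α+m)+1) * d^(2*(β+n)+1)) * ((C * D *
          ((a*b)^(-(α+m+1/2)) * (c*d)^(-(β+n+1/2)))) * (b^m*d^n)⁻¹)) := by
          gcongr
      _ = _ := by
          have e1 : (a*b)^(-(α+m+1/2)) = (a*b)^(-(α+1/2)) * (a^m * b^m)⁻¹ := by
            rw [← Real.mul_rpow s1.le s2.le, ← Real.rpow_neg (by positivity),
              ← Real.rpow_add (by positivity)]
            congr 1; ring
          have e2 : (c*d)^(-(β+n+1/2)) = (c*d)^(-(β+1/2)) * (c^n * d^n)⁻¹ := by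
            rw [← Real.mul_rpow c1.le c2.le, ← Real.rpow_neg (by positivity),
              ← Real.rpow_add (by positivity)]
            congr 1; ring
          have e3 : b^(2*(α+m)+1) = b^(2*α+1) * b^m * b^m := by
            rw [← Real.rpow_add s2, ← Real.rpow_add s2]; congr 1; ring
          have e4 : d^(2*(β+n)+1) = d^(2*β+1) * d^n * d^n := by
            rw [← Real.rpow_add c2, ← Real.rpow_add c2]; congr 1; ring
          rw [e1, e2, e3, e4]
          have := (Real.rpow_pos_of_pos s1 m).ne'
          have := (Real.rpow_pos_of_pos s2 m).ne'
          have := (Real.rpow_pos_of_pos c1 n).ne'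
          have := (Real.rpow_pos_of_pos c2 n).ne'
          field_simp
  rw [← ENNReal.ofReal_inv_of_pos (by positivity)]
  simp only [← mul_assoc]
  apply mul_le_mul_left
  rw [← ENNReal.ofReal_mul (by positivity), ← ENNReal.ofReal_mul (by positivity),
    ← ENNReal.ofReal_mul' (by positivity), ← ENNReal.ofReal_mul (by positivity),
    ← ENNReal.ofReal_mul (by positivity)]
  apply ENNReal.ofReal_le_ofReal
  refine le_trans (le_of_eq ?_) (key.trans (le_of_eq ?_)) <;> ring

lemma jac_Tj {σ α β C : ℝ} (hC : 0 < C) (hα : -(1/2) < α) (hβ : -(1/2) < β)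
    (h : ∀ α' β' θ φ : ℝ, -(1/2) < α' → β ≤ β' → θ ∈ Ioo 0 π → φ ∈ Ioo 0 π → θ ≠ φ →
      jacobiFracKernel σ α' β' θ φ ≤ C * |Real.sin ((θ-φ)/2)|^(σ-1) *
        ((Real.sin (θ/2) * Real.sin (φ/2))^(-(α'+1/2)) *
          (Real.cos (θ/2) * Real.cos (φ/2))^(-(β'+1/2))))
    {m n θ : ℝ} (hm : 0 ≤ m) (hn : 0 ≤ n) (hθ : θ ∈ Ioo 0 π) (f : ℝ → ℝ≥0∞) :
    ENNReal.ofReal ((Real.sin (θ/2))^m * (Real.cos (θ/2))^n) *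
      ∫⁻ φ, ENNReal.ofReal (jacobiFracKernel σ (α+m) (β+n) θ φ) *
        (ENNReal.ofReal ((Real.sin (φ/2))^m * (Real.cos (φ/2))^n))⁻¹ * f φ
        ∂(jacobiMeasure (α+m) (β+n)) ≤
    ∫⁻ φ, ENNReal.ofReal C * ENNReal.ofReal (jacKer σ α β θ φ) * f φ ∂(jacobiMeasure α β) := by
  rw [jac_lint, jac_lint, ← lintegral_const_mul' _ _ ENNReal.ofReal_ne_top]
  apply lintegral_mono_ae
  have hne : ∀ᵐ φ : ℝ ∂(volume.restrict (Ioo 0 π)), φ ≠ θ := by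
    apply ae_restrict_of_ae
    rw [ae_iff]; simp
  filter_upwards [hne, ae_restrict_mem measurableSet_Ioo] with φ h1 h2
  exact jac_Tj_pt hθ h2 (h (α+m) (β+n) θ φ (by linarith) (by linarith) hθ h2 h1.symm) hC _

lemma jac_mem_ae (α β : ℝ) : ∀ᵐ θ ∂(jacobiMeasure α β), θ ∈ Ioo (0:ℝ) π := by
  unfold jacobiMeasure
  exact (withDensity_absolutelyContinuous _ _).ae_le (ae_restrict_mem measurableSet_Ioo)

/-- Vector-valued `L^p(dμ_{α,β}) → L^q(dμ_{α,β})` inequality for the twisted Jacobi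
fractional integrals `T_j f(θ) = u_j(θ) ∫_0^π K_σ^{α+aj,β+bj}(θ,φ) u_j(φ)^{-1} f(φ)
dμ_{α+aj,β+bj}(φ)`, where `u_j(θ) = (sin(θ/2))^{aj}(cos(θ/2))^{bj}`, with a constant
depending only on `σ, α, β, p, q`. -/
theorem jacobi_fracIntegral_vector_valued (σ α β p q : ℝ) (hσ0 : 0 < σ) (hσ1 : σ < 1)
    (hα : -(1/2) ≤ α) (hβ : -(1/2) < β)
    (hp : max ((2*α+2)/(α+3/2)) ((2*β+2)/(β+3/2)) < p) (hpq : p ≤ q)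
    (hq : q < min ((2*α+2)/(α+1/2)) ((2*β+2)/(β+1/2)))
    (hσpq : 1/q ≥ 1/p - min (σ/(2*α+2)) (σ/(2*β+2))) :
    ∃ C : ℝ, 0 < C ∧ ∀ a b : ℝ, 0 ≤ a → 0 ≤ b →
      ∀ f : ℕ → ℝ → ℝ, (∀ j, Measurable (f j)) → (∀ j θ, 0 ≤ f j θ) →
      (∫⁻ θ, (∑' j : ℕ,
            (ENNReal.ofReal ((Real.sin (θ/2)) ^ (a*j) * (Real.cos (θ/2)) ^ (b*j)) *
              ∫⁻ φ, ENNReal.ofReal (jacobiFracKernel σ (α + a*j) (β + b*j) θ φ) *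
                (ENNReal.ofReal ((Real.sin (φ/2)) ^ (a*j) * (Real.cos (φ/2)) ^ (b*j)))⁻¹ *
                ENNReal.ofReal (f j φ) ∂(jacobiMeasure (α + a*j) (β + b*j))) ^ (2:ℝ)) ^ (q/2)
          ∂(jacobiMeasure α β)) ^ (1/q) ≤
        ENNReal.ofReal C *
          (∫⁻ θ, (∑' j : ℕ, ENNReal.ofReal (f j θ) ^ (2:ℝ)) ^ (p/2)
            ∂(jacobiMeasure α β)) ^ (1/p) := by
  have hqa := lt_of_lt_of_le hq (min_le_left _ _)
  have hqb := lt_of_lt_of_le hq (min_le_right _ _)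
  have hpa := lt_of_le_of_lt (le_max_left _ _) hp
  have hpb := lt_of_le_of_lt (le_max_right _ _) hp
  have hα3 : 0 < α + 3/2 := by linarith
  have hβ3 : 0 < β + 3/2 := by linarith
  have hp0 : 0 < p := lt_trans (div_pos (by linarith) hα3) hpa
  have hq0 : 0 < q := by linarith
  have hα' : -(1/2) < α := by
    rcases hα.lt_or_eq with h | h
    · exact h
    · exfalso
      rw [← h] at hqa
      norm_num at hqa
      linarith
  have hp1 : 1 ≤ p := by
    refine le_trans ?_ hpa.le
    rw [le_div_iff₀ hα3]; linarith
  have hpinv : 1/p = p⁻¹ := one_div p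
  have hpp : p * (1/p) = 1 := by field_simp
  have hqq : q * (1/q) = 1 := by field_simp
  have hip : 0 < 1/p := by positivity
  have hiq : 0 < 1/q := by positivity
  rw [lt_div_iff₀ (by linarith)] at hqa hqb
  rw [div_lt_iff₀ (by assumption)] at hpa hpb
  have hma : 1/p - 1/q ≤ σ/(2*α+2) := by
    have := min_le_left (σ/(2*α+2)) (σ/(2*β+2)); linarith
  have hmb : 1/p - 1/q ≤ σ/(2*β+2) := by
    have := min_le_right (σ/(2*α+2)) (σ/(2*β+2)); linarith
  rw [le_div_iff₀ (by linarith)] at hma hmb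
  have hA : 0 < (2*α+2)*(1/q) - (α+1/2) := by
    have := mul_lt_mul_of_pos_right hqa hiq
    have e : q*(α+1/2)*(1/q) = α+1/2 := by field_simp
    linarith
  have hA' : 0 < (2*β+2)*(1/q) - (β+1/2) := by
    have := mul_lt_mul_of_pos_right hqb hiq
    have e : q*(β+1/2)*(1/q) = β+1/2 := by field_simp
    linarith
  have hB : 0 < (2*α+2)*(1-1/p) - (α+1/2) := by
    have := mul_lt_mul_of_pos_right hpa hip
    have e : p*(α+3/2)*(1/p) = α+3/2 := by field_simp
    linarith
  have hB' : 0 < (2*β+2)*(1-1/p) - (β+1/2) := by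
    have := mul_lt_mul_of_pos_right hpb hip
    have e : p*(β+3/2)*(1/p) = β+3/2 := by field_simp
    linarith
  obtain ⟨C0, hC0, hker⟩ := jac_frac hσ0 hσ1 hβ
  obtain ⟨C1, hC1, hsc⟩ := jac_scalar (σ := σ) (α := α) (β := β) (p := p) (q := q) hσ0 hσ1 hα' hβ
    hp1 hpq (by linarith) (by linarith) hA hB hA' hB'
  refine ⟨C0 * C1, mul_pos hC0 hC1, fun a b ha hb f hf hf0 => ?_⟩
  set F : ℝ → ENNReal := fun φ => (∑' j : ℕ, ENNReal.ofReal (f j φ) ^ (2:ℝ)) ^ (1/2:ℝ) with hF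
  have hfm : ∀ j, Measurable (fun φ => ENNReal.ofReal (f j φ)) := fun j => (hf j).ennreal_ofReal
  have hFm : Measurable F := by
    rw [hF]
    exact (Measurable.ennreal_tsum (fun j => (hfm j).pow_const _)).pow_const _
  have hright : ∀ θ, (∑' j : ℕ, ENNReal.ofReal (f j θ) ^ (2:ℝ)) ^ (p/2) = F θ ^ p := by
    intro θ
    simp only [hF]
    rw [← ENNReal.rpow_mul]; congr 1; ring
  simp_rw [hright]
  have hpt : ∀ᵐ θ ∂(jacobiMeasure α β), (∑' j : ℕ,
            (ENNReal.ofReal ((Real.sin (θ/2)) ^ (a*j) * (Real.cos (θ/2)) ^ (b*j)) *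
              ∫⁻ φ, ENNReal.ofReal (jacobiFracKernel σ (α + a*j) (β + b*j) θ φ) *
                (ENNReal.ofReal ((Real.sin (φ/2)) ^ (a*j) * (Real.cos (φ/2)) ^ (b*j)))⁻¹ *
                ENNReal.ofReal (f j φ) ∂(jacobiMeasure (α + a*j) (β + b*j))) ^ (2:ℝ)) ^ (q/2) ≤
      (ENNReal.ofReal C0) ^ q *
        (∫⁻ φ, ENNReal.ofReal (jacKer σ α β θ φ) * F φ ∂(jacobiMeasure α β)) ^ q := by
    filter_upwards [jac_mem_ae α β] with θ hθ
    have hdm : Measurable (fun φ => ENNReal.ofReal C0 * ENNReal.ofReal (jacKer σ α β θ φ)) :=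
      (jacKer_meas' σ α β θ).ennreal_ofReal.const_mul _
    set ν := (jacobiMeasure α β).withDensity
      (fun φ => ENNReal.ofReal C0 * ENNReal.ofReal (jacKer σ α β θ φ)) with hν
    have hνi : ∀ G : ℝ → ENNReal, Measurable G → ∫⁻ φ, G φ ∂ν =
        ∫⁻ φ, ENNReal.ofReal C0 * ENNReal.ofReal (jacKer σ α β θ φ) * G φ
          ∂(jacobiMeasure α β) := by
      intro G hG
      rw [hν, lintegral_withDensity_eq_lintegral_mul _ hdm hG]
      rfl
    have h1 : (∑' j : ℕ,
            (ENNReal.ofReal ((Real.sin (θ/2)) ^ (a*j) * (Real.cos (θ/2)) ^ (b*j)) *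
              ∫⁻ φ, ENNReal.ofReal (jacobiFracKernel σ (α + a*j) (β + b*j) θ φ) *
                (ENNReal.ofReal ((Real.sin (φ/2)) ^ (a*j) * (Real.cos (φ/2)) ^ (b*j)))⁻¹ *
                ENNReal.ofReal (f j φ) ∂(jacobiMeasure (α + a*j) (β + b*j))) ^ (2:ℝ)) ≤
        (∫⁻ φ, F φ ∂ν) ^ (2:ℝ) := by
      refine le_trans (ENNReal.tsum_le_tsum fun j => ?_)
        (jac_minkowski ν (fun j φ => ENNReal.ofReal (f j φ)) hfm)
      apply ENNReal.rpow_le_rpow _ (by norm_num)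
      rw [hνi _ (hfm j)]
      exact jac_Tj hC0 hα' hβ hker (by positivity) (by positivity) hθ _
    refine (ENNReal.rpow_le_rpow h1 (by positivity : 0 ≤ q/2)).trans (le_of_eq ?_)
    rw [hνi _ hFm, ← ENNReal.rpow_mul, ← ENNReal.mul_rpow_of_nonneg _ _ hq0.le,
      ← lintegral_const_mul' _ _ ENNReal.ofReal_ne_top, show 2*(q/2) = q by ring]
    simp_rw [mul_assoc]
  calc _ ≤ (∫⁻ θ, (ENNReal.ofReal C0) ^ q *
        (∫⁻ φ, ENNReal.ofReal (jacKer σ α β θ φ) * F φ ∂(jacobiMeasure α β)) ^ q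
        ∂(jacobiMeasure α β)) ^ (1/q) :=
        ENNReal.rpow_le_rpow (lintegral_mono_ae hpt) hiq.le
    _ = ENNReal.ofReal C0 * (∫⁻ θ,
        (∫⁻ φ, ENNReal.ofReal (jacKer σ α β θ φ) * F φ ∂(jacobiMeasure α β)) ^ q
        ∂(jacobiMeasure α β)) ^ (1/q) := by
        rw [lintegral_const_mul' _ _ (ENNReal.rpow_ne_top_of_nonneg hq0.le ENNReal.ofReal_ne_top),
          ENNReal.mul_rpow_of_nonneg _ _ hiq.le, ← ENNReal.rpow_mul, hqq, ENNReal.rpow_one]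
    _ ≤ ENNReal.ofReal C0 * (ENNReal.ofReal C1 *
        (∫⁻ θ, F θ ^ p ∂(jacobiMeasure α β)) ^ (1/p)) := mul_le_mul_right (hsc F hFm) _
    _ = _ := by rw [← mul_assoc, ← ENNReal.ofReal_mul hC0.le]
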